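/- arXiv:hep-th/9911030 — 6 statements merged into one kernel-verified Lean document; each statement's English description precedes it below -/
import Mathlib

section
/- Let 1 ≤ n ≤ N be a site index and let E be any linear operator on W_n = ℂ^{d_n}. Denote by E_n the operator on H acting as E on the n-th tensor factor and as the identity elsewhere, and by E_0 the operator E acting on the auxiliary copy of W_n. Assume that each transfer matrix t^{(i)}(ξ_i), 1 ≤ i ≤ n, is an invertible operator on H. Then E_n = (∏_{i=1}^{n−1} t^{(i)}(ξ_i)) · tr_0( E_0 · T^{(n)}_0(ξ_n) ) · (∏_{i=1}^{n} t^{(i)}(ξ_i))^{−1}, where tr_0 denotes the partial trace over the auxiliary copy of W_n. -/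
open Matrix

noncomputable section

variable {N : ℕ}

/-- Embedding of an operator on (an auxiliary copy of `W_n`) ⊗ `W_i` into
(auxiliary space) ⊗ H, acting on the auxiliary leg and the `i`-th site of
H = W₁ ⊗ ⋯ ⊗ W_N, with `W_j = ℂ^{d_j}`. -/
def embAux (d : Fin N → ℕ) (n i : Fin N)
    (M : Matrix (Fin (d n) × Fin (d i)) (Fin (d n) × Fin (d i)) ℂ) :
    Matrix (Fin (d n) × (∀ j, Fin (d j))) (Fin (d n) × (∀ j, Fin (d j))) ℂ :=
  Matrix.of fun p q =>
    M (p.1, p.2 i) (q.1, q.2 i) *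
      ∏ j : Fin N, if j = i then 1 else (if p.2 j = q.2 j then 1 else 0)

/-- The monodromy matrix `T⁽ⁿ⁾₀(λ) = R^{nN}₀N(λ,ξ_N) ⋯ R^{n1}₀₁(λ,ξ_1)` with auxiliary
space an extra copy of `W_n`. -/
def monodromy (d : Fin N → ℕ) (ξ : Fin N → ℂ)
    (R : ∀ m n : Fin N, ℂ → ℂ → Matrix (Fin (d m) × Fin (d n)) (Fin (d m) × Fin (d n)) ℂ)
    (n : Fin N) (lam : ℂ) :
    Matrix (Fin (d n) × (∀ j, Fin (d j))) (Fin (d n) × (∀ j, Fin (d j))) ℂ :=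
  ((List.ofFn fun i : Fin N => embAux d n i (R n i lam (ξ i))).reverse).prod

/-- Partial trace over the (first) auxiliary factor. -/
def ptr {α H : Type*} [Fintype α] (M : Matrix (α × H) (α × H) ℂ) : Matrix H H ℂ :=
  Matrix.of fun x y => ∑ c : α, M (c, x) (c, y)

/-- The transfer matrix `t⁽ⁿ⁾(λ) = tr₀ T⁽ⁿ⁾₀(λ)`. -/
def transfer (d : Fin N → ℕ) (ξ : Fin N → ℂ)
    (R : ∀ m n : Fin N, ℂ → ℂ → Matrix (Fin (d m) × Fin (d n)) (Fin (d m) × Fin (d n)) ℂ)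
    (n : Fin N) (lam : ℂ) : Matrix (∀ j, Fin (d j)) (∀ j, Fin (d j)) ℂ :=
  ptr (monodromy d ξ R n lam)

/-- An operator `E` acting on the auxiliary (first) factor, identity on the rest. -/
def embFst {α H : Type*} [DecidableEq H] (E : Matrix α α ℂ) :
    Matrix (α × H) (α × H) ℂ :=
  Matrix.of fun p q => E p.1 q.1 * (if p.2 = q.2 then 1 else 0)

/-- The operator acting as `E` on the `n`-th site of H and as the identity elsewhere. -/
def embSite (d : Fin N → ℕ) (n : Fin N) (E : Matrix (Fin (d n)) (Fin (d n)) ℂ) :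
    Matrix (∀ j, Fin (d j)) (∀ j, Fin (d j)) ℂ :=
  Matrix.of fun x y =>
    E (x n) (y n) * ∏ j : Fin N, if j = n then 1 else (if x j = y j then 1 else 0)

/-- Embedding of a two-leg operator into legs 1,2 of a three-fold tensor product. -/
def e12 {α β γ : Type*} [DecidableEq γ]
    (M : Matrix (α × β) (α × β) ℂ) : Matrix (α × β × γ) (α × β × γ) ℂ :=
  Matrix.of fun p q => M (p.1, p.2.1) (q.1, q.2.1) * (if p.2.2 = q.2.2 then 1 else 0)

/-- Embedding of a two-leg operator into legs 1,3 of a three-fold tensor product. -/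
def e13 {α β γ : Type*} [DecidableEq β]
    (M : Matrix (α × γ) (α × γ) ℂ) : Matrix (α × β × γ) (α × β × γ) ℂ :=
  Matrix.of fun p q => M (p.1, p.2.2) (q.1, q.2.2) * (if p.2.1 = q.2.1 then 1 else 0)

/-- Embedding of a two-leg operator into legs 2,3 of a three-fold tensor product. -/
def e23 {α β γ : Type*} [DecidableEq α]
    (M : Matrix (β × γ) (β × γ) ℂ) : Matrix (α × β × γ) (α × β × γ) ℂ :=
  Matrix.of fun p q => M (p.2.1, p.2.2) (q.2.1, q.2.2) * (if p.1 = q.1 then 1 else 0)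

section DescendingProducts

variable {A : Type*}

/-- The descending product `f (a + m - 1) * ⋯ * f (a + 1) * f a`. -/
def descProd [Monoid A] (f : ℕ → A) (a : ℕ) : ℕ → A
  | 0 => 1
  | m + 1 => f (a + m) * descProd f a m

lemma descProd_add [Monoid A] (f : ℕ → A) (a l m : ℕ) :
    descProd f a (l + m) = descProd f (a + l) m * descProd f a l := by
  induction m with
  | zero => simp [descProd]
  | succ m ih => rw [← add_assoc, descProd, ih, descProd, mul_assoc, add_assoc]

lemma descProd_succ_bot [Monoid A] (f : ℕ → A) (a m : ℕ) :
    descProd f a (m + 1) = descProd f (a + 1) m * f a := by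
  rw [add_comm, descProd_add]
  simp [descProd]

lemma map_descProd {B F : Type*} [Monoid A] [Monoid B] [FunLike F A B] [MonoidHomClass F A B]
    (g : F) (f : ℕ → A) (a m : ℕ) :
    g (descProd f a m) = descProd (fun k => g (f k)) a m := by
  induction m with
  | zero => simp [descProd]
  | succ m ih => simp [descProd, ih]

lemma descProd_congr [Monoid A] {f g : ℕ → A} {a m : ℕ}
    (h : ∀ k, a ≤ k → k < a + m → f k = g k) : descProd f a m = descProd g a m := by
  induction m with
  | zero => rfl
  | succ m ih =>
    rw [descProd, descProd, h _ (by omega) (by omega), ih fun k hk hk' => h k hk (by omega)]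

lemma SemiconjBy.descProd [Monoid A] {x : A} {f g : ℕ → A} {a m : ℕ}
    (h : ∀ k, a ≤ k → k < a + m → SemiconjBy x (f k) (g k)) :
    SemiconjBy x (descProd f a m) (descProd g a m) := by
  induction m with
  | zero => exact SemiconjBy.one_right x
  | succ m ih =>
    exact (h _ (by omega) (by omega)).mul_right (ih fun k hk hk' => h k hk (by omega))

lemma Commute.descProd_right [Monoid A] {x : A} {f : ℕ → A} {a m : ℕ}
    (h : ∀ k, a ≤ k → k < a + m → Commute x (f k)) : Commute x (descProd f a m) :=
  SemiconjBy.descProd h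

lemma prod_reverse_ofFn [Monoid A] {n : ℕ} (f : Fin n → A) :
    (List.ofFn f).reverse.prod = descProd (fun k => if h : k < n then f ⟨k, h⟩ else 1) 0 n := by
  induction n with
  | zero => simp [descProd]
  | succ n ih =>
    rw [List.ofFn_succ_last, List.reverse_append, List.reverse_singleton, List.singleton_append,
      List.prod_cons, ih, descProd]
    congr 1
    · simp [Fin.last]
    · refine descProd_congr fun k _ hk => ?_
      rw [dif_pos (by omega), dif_pos (by omega)]
      rfl

variable [Ring A] [Algebra ℂ A] {r : ℕ → ℕ → A}

/-- The transfer matrix at an inhomogeneity, `r_{i,i-1} ⋯ r_{i,0} r_{i,N-1} ⋯ r_{i,i+1}`. -/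
def cyclicProd (N : ℕ) (r : ℕ → ℕ → A) (i : ℕ) : A :=
  descProd (r i) 0 i * descProd (r i) (i + 1) (N - (i + 1))

lemma prod_descProd_mul_descProd {N n : ℕ} (hn : n < N)
    (hunit : ∀ i j, i ≠ j → ∃ c : ℂ, r i j * r j i = c • 1)
    (hcomm : ∀ i j k l, i ≠ k → i ≠ l → j ≠ k → j ≠ l → Commute (r i j) (r k l))
    {k : ℕ} (hk : k ≤ n) :
    ∃ c : ℂ, ((List.range k).map fun i => descProd (r i) n (N - n)).prod * descProd (r n) 0 k =
      c • ((List.range k).map fun i => descProd (r i) (n + 1) (N - (n + 1))).prod := by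
  induction k with
  | zero => exact ⟨1, by simp [descProd]⟩
  | succ k ih =>
    obtain ⟨c, hc⟩ := ih (by omega)
    obtain ⟨c', hc'⟩ := hunit k n (by omega)
    have hcom : Commute (descProd (r k) (n + 1) (N - (n + 1))) (descProd (r n) 0 k) :=
      Commute.descProd_right fun i _ hi => (Commute.descProd_right fun j hj _ =>
        hcomm _ _ _ _ (by omega) (by omega) (by omega) (by omega)).symm
    refine ⟨c * c', ?_⟩
    rw [List.prod_range_succ, List.prod_range_succ, show N - n = N - (n + 1) + 1 by omega,
      descProd_succ_bot, descProd, zero_add, ← show N - n = N - (n + 1) + 1 by omega]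
    generalize ((List.range k).map fun i => descProd (r i) n (N - n)).prod = S at *
    generalize ((List.range k).map fun i => descProd (r i) (n + 1) (N - (n + 1))).prod = S' at *
    generalize descProd (r k) (n + 1) (N - (n + 1)) = C at *
    generalize descProd (r n) 0 k = D at *
    calc S * (C * r k n) * (r n k * D) = S * C * (r k n * r n k) * D := by simp only [mul_assoc]
      _ = c' • (S * (C * D)) := by rw [hc']; simp [mul_assoc]
      _ = c' • (S * D * C) := by rw [hcom.eq, mul_assoc]
      _ = (c * c') • (S' * C) := by rw [hc, smul_mul_assoc, smul_smul, mul_comm]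

lemma prod_cyclicProd {N n : ℕ} (hn : n ≤ N)
    (hunit : ∀ i j, i ≠ j → ∃ c : ℂ, r i j * r j i = c • 1)
    (hcomm : ∀ i j k l, i ≠ k → i ≠ l → j ≠ k → j ≠ l → Commute (r i j) (r k l)) :
    ∃ c : ℂ, ((List.range n).map (cyclicProd N r)).prod =
      c • ((List.range n).map fun i => descProd (r i) n (N - n)).prod := by
  induction n with
  | zero => exact ⟨1, by simp⟩
  | succ n ih =>
    obtain ⟨c, hc⟩ := ih (by omega)
    obtain ⟨c', hc'⟩ := prod_descProd_mul_descProd (N := N) (n := n) (by omega) hunit hcomm le_rfl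
    refine ⟨c * c', ?_⟩
    rw [List.prod_range_succ, List.prod_range_succ, hc, cyclicProd, smul_mul_assoc, ← mul_assoc,
      hc', smul_mul_assoc, smul_smul]

/-- An operator commuting with all `r i j`, `i, j ≠ n`, commutes with
`t_0 ⋯ t_{n-1} · r_{n,n-1} ⋯ r_{n,0}`. -/
lemma commute_prod_cyclicProd_mul {N n : ℕ} (hn : n < N)
    (hunit : ∀ i j, i ≠ j → ∃ c : ℂ, r i j * r j i = c • 1)
    (hcomm : ∀ i j k l, i ≠ k → i ≠ l → j ≠ k → j ≠ l → Commute (r i j) (r k l))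
    {x : A} (hx : ∀ i j, i ≠ n → j ≠ n → Commute x (r i j)) :
    Commute x (((List.range n).map (cyclicProd N r)).prod * descProd (r n) 0 n) := by
  obtain ⟨c, hc⟩ := prod_cyclicProd hn.le hunit hcomm
  obtain ⟨c', hc'⟩ := prod_descProd_mul_descProd hn hunit hcomm le_rfl
  rw [hc, smul_mul_assoc, hc']
  refine ((Commute.list_prod_right _ _ fun y hy => ?_).smul_right c').smul_right c
  obtain ⟨i, hi, rfl⟩ := List.mem_map.1 hy
  rw [List.mem_range] at hi
  exact Commute.descProd_right fun j hj _ => hx i j (by omega) (by omega)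

end DescendingProducts

section TwoSite

variable {A α β : Type*} [Ring A] [Algebra ℂ A] [Fintype α] [DecidableEq α] [Fintype β]
  [DecidableEq β]

/-- The operator `∑ M_{(a,c),(b,e)} φ(e_{ab}) ψ(e_{ce})` obtained from a two-leg operator `M`
by representing the first leg through `φ` and the second one through `ψ`. -/
def twoSite (φ : Matrix α α ℂ →ₐ[ℂ] A) (ψ : Matrix β β ℂ →ₐ[ℂ] A)
    (M : Matrix (α × β) (α × β) ℂ) : A :=
  ∑ a, ∑ b, φ (single a b 1) * ψ (of fun c e => M (a, c) (b, e))

variable {φ : Matrix α α ℂ →ₐ[ℂ] A} {ψ : Matrix β β ℂ →ₐ[ℂ] A}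

lemma Commute.twoSite_right {x : A} (hφ : ∀ F, Commute x (φ F)) (hψ : ∀ F, Commute x (ψ F))
    (M : Matrix (α × β) (α × β) ℂ) : Commute x (twoSite φ ψ M) :=
  Commute.sum_right _ _ _ fun _ _ => Commute.sum_right _ _ _ fun _ _ => (hφ _).mul_right (hψ _)

lemma sum_map_single_mul (φ : Matrix α α ℂ →ₐ[ℂ] A) (a b : α) (y : α → α → A) :
    φ (single a b 1) * ∑ c, ∑ e, φ (single c e 1) * y c e =
      ∑ e, φ (single a e 1) * y b e := by
  rw [Finset.mul_sum, Finset.sum_eq_single b]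
  · simp [Finset.mul_sum, ← mul_assoc, ← map_mul]
  · intro c _ hc
    simp [Finset.mul_sum, ← mul_assoc, ← map_mul, hc.symm]
  · simp

lemma twoSite_mul (h : ∀ E F, Commute (φ E) (ψ F)) (M M' : Matrix (α × β) (α × β) ℂ) :
    twoSite φ ψ (M * M') = twoSite φ ψ M * twoSite φ ψ M' := by
  have key (a b : α) : φ (single a b 1) * ψ (of fun c e => M (a, c) (b, e)) * twoSite φ ψ M' =
      ∑ e, φ (single a e 1) * (ψ (of fun c f => M (a, c) (b, f)) *
        ψ (of fun c f => M' (b, c) (e, f))) := by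
    rw [← sum_map_single_mul φ a b fun b' e =>
      ψ (of fun c f => M (a, c) (b, f)) * ψ (of fun c f => M' (b', c) (e, f)), mul_assoc]
    simp only [twoSite, Finset.mul_sum]
    refine Finset.sum_congr rfl fun b' _ => Finset.sum_congr rfl fun e _ => ?_
    rw [← mul_assoc, (h _ _).symm.mul_mul_mul_comm, mul_assoc]
  rw [twoSite, twoSite, Finset.sum_mul]
  refine Finset.sum_congr rfl fun a _ => ?_
  rw [Finset.sum_mul]
  simp only [key]
  rw [Finset.sum_comm]
  refine Finset.sum_congr rfl fun e _ => ?_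
  rw [← Finset.mul_sum]
  simp only [← map_mul, ← map_sum]
  congr 2
  ext c f
  simp [mul_apply, Matrix.sum_apply, Fintype.sum_prod_type]

lemma twoSite_smul_one (c : ℂ) : twoSite φ ψ (c • 1) = c • 1 := by
  have key (a b : α) : (of fun e f => (c • (1 : Matrix (α × β) (α × β) ℂ)) (a, e) (b, f)) =
      if a = b then c • (1 : Matrix β β ℂ) else 0 := by
    ext e f
    split_ifs with h <;> simp [one_apply, h]
  simp only [twoSite, key]
  have : ∑ a, φ (single a a 1) = 1 := by
    rw [← map_sum, sum_single_one, map_one]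
  simp [apply_ite ψ, ← Finset.smul_sum, this]

lemma map_eq_sum_single (ψ : Matrix β β ℂ →ₐ[ℂ] A) (M : Matrix β β ℂ) :
    ψ M = ∑ c, ∑ e, M c e • ψ (single c e 1) := by
  conv_lhs => rw [matrix_eq_sum_single M]
  simp only [map_sum, ← map_smul, smul_single, smul_eq_mul, mul_one]

lemma twoSite_swap (h : ∀ E F, Commute (φ E) (ψ F)) (M : Matrix (β × α) (β × α) ℂ) :
    twoSite ψ φ M = twoSite φ ψ (M.submatrix Prod.swap Prod.swap) := by
  simp only [twoSite]
  conv_lhs => enter [2, a, 2, b]; rw [map_eq_sum_single φ]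
  conv_rhs => enter [2, a, 2, b]; rw [map_eq_sum_single ψ]
  simp only [Finset.mul_sum, ← Fintype.sum_prod_type', mul_smul_comm, (h _ _).eq]
  refine Fintype.sum_equiv ⟨fun p => (p.2.2.1, p.2.2.2, p.1, p.2.1),
    fun p => (p.2.2.1, p.2.2.2, p.1, p.2.1), fun _ => rfl, fun _ => rfl⟩ _ _ fun p => ?_
  simp

end TwoSite

section Unitarity

variable {α β : Type*} [Fintype α] [DecidableEq α] [Fintype β] [DecidableEq β]

lemma yangBaxter_swap_apply (M : Matrix (α × β) (α × β) ℂ) (M' : Matrix (β × α) (β × α) ℂ)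
    (P : Matrix (α × α) (α × α) ℂ)
    (hP : ∀ i j k l, P (i, j) (k, l) = if i = l ∧ j = k then 1 else 0)
    (h : e12 (γ := α) M * e13 (β := β) P * e23 (α := α) M' =
      e23 (α := α) M' * e13 (β := β) P * e12 (γ := α) M) (a a' c c' : α) (b b' : β) :
    (if c = a' then (M * M'.submatrix Prod.swap Prod.swap) (a, b) (c', b') else 0) =
      if a = c' then (M' * M.submatrix Prod.swap Prod.swap) (b, c) (b', a') else 0 := by
  have := congrFun (congrFun h (a, b, c)) (a', b', c')
  simp only [mul_apply, e12, e13, e23, of_apply, Fintype.sum_prod_type, hP, Finset.sum_mul] at this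
  simp [ite_and] at this
  simp only [mul_apply, Fintype.sum_prod_type, submatrix_apply, Prod.swap_prod_mk]
  convert this using 2 <;> exact Finset.sum_comm

/-- Unitarity up to a scalar, as a consequence of the Yang–Baxter equation and the initial
condition. -/
lemma exists_mul_swap_eq_smul_one (M : Matrix (α × β) (α × β) ℂ) (M' : Matrix (β × α) (β × α) ℂ)
    (P : Matrix (α × α) (α × α) ℂ) (P' : Matrix (β × β) (β × β) ℂ)
    (hP : ∀ i j k l, P (i, j) (k, l) = if i = l ∧ j = k then 1 else 0)
    (hP' : ∀ i j k l, P' (i, j) (k, l) = if i = l ∧ j = k then 1 else 0)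
    (h : e12 (γ := α) M * e13 (β := β) P * e23 (α := α) M' =
      e23 (α := α) M' * e13 (β := β) P * e12 (γ := α) M)
    (h' : e12 (γ := β) M' * e13 (β := α) P' * e23 (α := β) M =
      e23 (α := β) M * e13 (β := α) P' * e12 (γ := β) M') :
    ∃ c : ℂ, M * M'.submatrix Prod.swap Prod.swap = c • 1 := by
  cases isEmpty_or_nonempty (α × β) with
  | inl _ => exact ⟨0, Subsingleton.elim _ _⟩
  | inr hne =>
    obtain ⟨a₀, b₀⟩ := hne
    refine ⟨(M * M'.submatrix Prod.swap Prod.swap) (a₀, b₀) (a₀, b₀), ?_⟩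
    ext ⟨a, b⟩ ⟨a', b'⟩
    have h₁ := yangBaxter_swap_apply M M' P hP h a a₀ a₀ a' b b'
    have h₂ := yangBaxter_swap_apply M' M P' hP' h' b b₀ b₀ b' a₀ a₀
    simp only [if_true] at h₁ h₂
    rw [h₁, h₂]
    by_cases ha : a = a' <;> by_cases hb : b = b' <;> simp [one_apply, ha, hb]

end Unitarity

section Blocks

lemma scalar_commute_of_entries {A α : Type*} [Ring A] [Fintype α] [DecidableEq α] {x : A}
    {Z : Matrix α α A} (h : ∀ a b, Commute x (Z a b)) :
    Commute (scalar α x) Z := by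
  rw [scalar_commute_iff]
  ext a b : 1
  exact (h a b).eq

variable {A α β : Type*} [Ring A] [Algebra ℂ A] [Fintype α] [DecidableEq α] [Fintype β]
  [DecidableEq β]

/-- The operator `M` whose first leg is kept as the block index and whose second leg is
represented through `ψ`. -/
def auxBlock (ψ : Matrix β β ℂ →ₐ[ℂ] A) (M : Matrix (α × β) (α × β) ℂ) : Matrix α α A :=
  of fun a b => ψ (of fun c e => M (a, c) (b, e))

/-- The permutation of the block index with the leg represented through `φ`. -/
def auxPerm (φ : Matrix α α ℂ →ₐ[ℂ] A) : Matrix α α A :=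
  of fun a b => φ (single b a 1)

variable {φ : Matrix α α ℂ →ₐ[ℂ] A} {ψ : Matrix β β ℂ →ₐ[ℂ] A}

lemma auxBlock_eq_auxPerm (P : Matrix (α × α) (α × α) ℂ)
    (hP : ∀ i j k l, P (i, j) (k, l) = if i = l ∧ j = k then 1 else 0) :
    auxBlock φ P = auxPerm φ := by
  ext a b
  simp only [auxBlock, auxPerm, of_apply, hP]
  congr 1
  ext c e
  simp [single_apply, and_comm, eq_comm]

lemma auxPerm_semiconjBy_auxBlock (h : ∀ E F, Commute (φ E) (ψ F))
    (M : Matrix (α × β) (α × β) ℂ) :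
    SemiconjBy (auxPerm φ) (auxBlock ψ M) (scalar α (twoSite φ ψ M)) := by
  have key (a b : α) : twoSite φ ψ M * φ (single b a 1) =
      ∑ c, φ (single c a 1) * ψ (of fun e f => M (c, e) (b, f)) := by
    rw [twoSite, Finset.sum_mul]
    refine Finset.sum_congr rfl fun c _ => ?_
    rw [Finset.sum_mul, Finset.sum_eq_single b]
    · rw [mul_assoc, ← (h _ _).eq, ← mul_assoc, ← map_mul, single_mul_single_same, mul_one]
    · intro e _ he
      rw [mul_assoc, ← (h _ _).eq, ← mul_assoc, ← map_mul, single_mul_single_of_ne (h := he)]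
      simp
    · simp
  ext a b : 1
  simp [auxPerm, auxBlock, mul_apply, diagonal_apply, key]

lemma auxPerm_semiconjBy_scalar (h : ∀ E F, Commute (φ E) (ψ F))
    (M : Matrix (α × β) (α × β) ℂ) :
    SemiconjBy (auxPerm φ) (scalar α (twoSite φ ψ M)) (auxBlock ψ M) := by
  have key (a b : α) : φ (single b a 1) * twoSite φ ψ M =
      ∑ c, ψ (of fun e f => M (a, e) (c, f)) * φ (single b c 1) := by
    rw [twoSite, sum_map_single_mul]
    simp only [(h _ _).eq]
  ext a b : 1
  rw [mul_apply, Finset.sum_eq_single b]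
  · simp [auxPerm, auxBlock, mul_apply, key]
  · intro c _ hc
    simp [hc]
  · simp

lemma trace_map_mul_auxPerm (E : Matrix α α ℂ) :
    (E.map (algebraMap ℂ A) * auxPerm φ).trace = φ E := by
  rw [map_eq_sum_single φ E]
  simp [trace, mul_apply, auxPerm, Algebra.smul_def]

/-- The trace of `E` times the monodromy at an inhomogeneity, where the latter contains the
permutation `auxPerm φ`. -/
lemma trace_map_mul_monodromy (E : Matrix α α ℂ) {x y : A} {X Y : Matrix α α A}
    (hX : SemiconjBy (auxPerm φ) X (scalar α x)) (hY : SemiconjBy (auxPerm φ) (scalar α y) Y)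
    (hxY : Commute (scalar α x) Y) :
    (E.map (algebraMap ℂ A) * (Y * (auxPerm φ * X))).trace = x * φ E * y := by
  have hxE : Commute (scalar α x) (E.map (algebraMap ℂ A)) :=
    scalar_commute_of_entries fun a b => (Algebra.commutes _ _).symm
  have : E.map (algebraMap ℂ A) * (Y * (auxPerm φ * X)) =
      scalar α x * (E.map (algebraMap ℂ A) * auxPerm φ) * scalar α y := by
    rw [hX.eq, ← mul_assoc Y, ← hxY.eq, mul_assoc _ Y, ← hY.eq, ← mul_assoc, ← hxE.eq]
    simp only [mul_assoc]
  rw [this, ← trace_map_mul_auxPerm (φ := φ) E]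
  simp [trace, Finset.mul_sum, Finset.sum_mul]

end Blocks

section Sites

lemma embSite_mul_apply (d : Fin N → ℕ) (n : Fin N) (E : Matrix (Fin (d n)) (Fin (d n)) ℂ)
    (Z : Matrix (∀ j, Fin (d j)) (∀ j, Fin (d j)) ℂ) (x y : ∀ j, Fin (d j)) :
    (embSite d n E * Z) x y = ∑ c, E (x n) c * Z (Function.update x n c) y := by
  rw [mul_apply]
  symm
  refine Finset.sum_of_injOn (Function.update x n) (Function.update_injective x n).injOn
    (by simp) (fun z _ hz => ?_) fun c _ => ?_
  · obtain ⟨j, hj, hjz⟩ : ∃ j, j ≠ n ∧ x j ≠ z j := by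
      by_contra! hcon
      refine hz ⟨z n, by simp, funext fun j => ?_⟩
      by_cases hj : j = n
      · subst hj; simp
      · simp [hj, hcon j hj]
    rw [embSite, of_apply, Finset.prod_eq_zero (Finset.mem_univ j) (by simp [hj, hjz])]
    simp
  · rw [embSite, of_apply, Finset.prod_eq_one fun j _ => ?_]
    · simp
    · by_cases hj : j = n <;> simp [hj]

lemma embSite_mul (d : Fin N → ℕ) (n : Fin N) (E F : Matrix (Fin (d n)) (Fin (d n)) ℂ) :
    embSite d n (E * F) = embSite d n E * embSite d n F := by
  rw [← mul_one (embSite d n F), ← mul_one (embSite d n (E * F))]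
  ext x y
  simp only [embSite_mul_apply, mul_apply (M := E), Function.update_self,
    Finset.mul_sum, Finset.sum_mul, mul_assoc]
  rw [Finset.sum_comm]
  refine Finset.sum_congr rfl fun c _ => Finset.sum_congr rfl fun e _ => ?_
  congr 2
  exact congrArg (fun z => (1 : Matrix (∀ j, Fin (d j)) _ ℂ) z y)
    (Function.update_idem (β := fun j => Fin (d j)) c e x).symm

lemma embSite_commute (d : Fin N → ℕ) {m n : Fin N} (h : m ≠ n)
    (E : Matrix (Fin (d m)) (Fin (d m)) ℂ) (F : Matrix (Fin (d n)) (Fin (d n)) ℂ) :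
    Commute (embSite d m E) (embSite d n F) := by
  rw [Commute, SemiconjBy, ← mul_one (embSite d n F), ← mul_one (embSite d m E), mul_assoc,
    mul_assoc, one_mul, one_mul]
  ext x y
  simp only [embSite_mul_apply, Function.update_of_ne h, Function.update_of_ne h.symm,
    Finset.mul_sum]
  rw [Finset.sum_comm]
  refine Finset.sum_congr rfl fun c _ => Finset.sum_congr rfl fun e _ => ?_
  rw [Function.update_comm h, mul_left_comm]

lemma embSite_smul_one (d : Fin N → ℕ) (n : Fin N) (c : ℂ) :
    embSite d n (c • 1) = c • 1 := by
  rw [← mul_one (embSite d n (c • 1))]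
  ext x y
  simp [embSite_mul_apply, one_apply (n := Fin (d n))]
  exact Or.inl (congrArg (fun z => (1 : Matrix (∀ j, Fin (d j)) _ ℂ) z y)
    (Function.update_eq_self n x))

/-- The embedding of operators on the `n`-th site as a homomorphism of algebras. -/
def siteHom (d : Fin N → ℕ) (n : Fin N) :
    Matrix (Fin (d n)) (Fin (d n)) ℂ →ₐ[ℂ] Matrix (∀ j, Fin (d j)) (∀ j, Fin (d j)) ℂ where
  toFun := embSite d n
  map_one' := by simpa using embSite_smul_one d n 1
  map_mul' := embSite_mul d n
  map_zero' := by simpa using embSite_smul_one d n 0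
  map_add' E F := by ext x y; simp [embSite, add_mul]
  commutes' c := by
    simpa only [Algebra.algebraMap_eq_smul_one] using embSite_smul_one d n c

lemma siteHom_commute (d : Fin N → ℕ) {m n : Fin N} (h : m ≠ n)
    (E : Matrix (Fin (d m)) (Fin (d m)) ℂ) (F : Matrix (Fin (d n)) (Fin (d n)) ℂ) :
    Commute (siteHom d m E) (siteHom d n F) :=
  embSite_commute d h E F

lemma compRingEquiv_auxBlock (d : Fin N → ℕ) (n i : Fin N)
    (M : Matrix (Fin (d n) × Fin (d i)) (Fin (d n) × Fin (d i)) ℂ) :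
    compRingEquiv (Fin (d n)) (∀ j, Fin (d j)) ℂ (auxBlock (siteHom d i) M) =
      embAux d n i M := rfl

lemma compRingEquiv_map_algebraMap {α H : Type*} [Fintype α] [Fintype H] [DecidableEq H]
    (E : Matrix α α ℂ) :
    compRingEquiv α H ℂ (E.map (algebraMap ℂ (Matrix H H ℂ))) = embFst E := by
  ext p q
  simp [comp_apply, embFst, algebraMap_matrix_apply, mul_ite]

lemma ptr_compRingEquiv {α H : Type*} [Fintype α] [Fintype H] (Z : Matrix α α (Matrix H H ℂ)) :
    ptr (compRingEquiv α H ℂ Z) = Z.trace := by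
  ext x y
  simp [ptr, trace, comp_apply, Matrix.sum_apply]

end Sites

section Chain

variable (d : Fin N → ℕ) (ξ : Fin N → ℂ)
  (R : ∀ m n : Fin N, ℂ → ℂ → Matrix (Fin (d m) × Fin (d n)) (Fin (d m) × Fin (d n)) ℂ)

/-- `R^{ij}(ξ_i, ξ_j)` acting on the sites `i` and `j` of `H`; the identity for indices which
are not sites. -/
def siteR (i j : ℕ) : Matrix (∀ j, Fin (d j)) (∀ j, Fin (d j)) ℂ :=
  if h : i < N ∧ j < N then
    twoSite (siteHom d ⟨i, h.1⟩) (siteHom d ⟨j, h.2⟩)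
      (R ⟨i, h.1⟩ ⟨j, h.2⟩ (ξ ⟨i, h.1⟩) (ξ ⟨j, h.2⟩))
  else 1

variable {d ξ R}

lemma siteHom_commute_siteR {n : Fin N} {i j : ℕ} (hi : i ≠ n) (hj : j ≠ n)
    (E : Matrix (Fin (d n)) (Fin (d n)) ℂ) : Commute (siteHom d n E) (siteR d ξ R i j) := by
  unfold siteR
  split_ifs with h
  · exact Commute.twoSite_right
      (fun _ => siteHom_commute d (Fin.ne_of_val_ne hi.symm) _ _)
      (fun _ => siteHom_commute d (Fin.ne_of_val_ne hj.symm) _ _) _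
  · exact Commute.one_right _

lemma siteR_commute {i j k l : ℕ} (hik : i ≠ k) (hil : i ≠ l) (hjk : j ≠ k) (hjl : j ≠ l) :
    Commute (siteR d ξ R i j) (siteR d ξ R k l) := by
  rw [siteR.eq_1 d ξ R k l]
  split_ifs with h
  · exact Commute.twoSite_right
      (fun _ => (siteHom_commute_siteR (n := ⟨k, h.1⟩) hik hjk _).symm)
      (fun _ => (siteHom_commute_siteR (n := ⟨l, h.2⟩) hil hjl _).symm) _
  · exact Commute.one_right _

lemma siteR_mul_siteR_swap
    (hYB : ∀ (m n p : Fin N) (lam mu nu : ℂ),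
      e12 (γ := Fin (d p)) (R m n lam mu) * e13 (β := Fin (d n)) (R m p lam nu) *
          e23 (α := Fin (d m)) (R n p mu nu) =
        e23 (α := Fin (d m)) (R n p mu nu) * e13 (β := Fin (d n)) (R m p lam nu) *
          e12 (γ := Fin (d p)) (R m n lam mu))
    (hP : ∀ (n : Fin N) (lam : ℂ) (i j k l : Fin (d n)),
      R n n lam lam (i, j) (k, l) = if i = l ∧ j = k then 1 else 0)
    {i j : ℕ} (hij : i ≠ j) :
    ∃ c : ℂ, siteR d ξ R i j * siteR d ξ R j i = c • 1 := by
  by_cases h : i < N ∧ j < N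
  · obtain ⟨c, hc⟩ := exists_mul_swap_eq_smul_one _ _ _ _
      (hP ⟨i, h.1⟩ (ξ ⟨i, h.1⟩)) (hP ⟨j, h.2⟩ (ξ ⟨j, h.2⟩))
      (hYB ⟨i, h.1⟩ ⟨j, h.2⟩ ⟨i, h.1⟩ _ (ξ ⟨j, h.2⟩) _)
      (hYB ⟨j, h.2⟩ ⟨i, h.1⟩ ⟨j, h.2⟩ _ (ξ ⟨i, h.1⟩) _)
    have hcom := siteHom_commute d (m := ⟨i, h.1⟩) (n := ⟨j, h.2⟩) (by simpa using hij)
    refine ⟨c, ?_⟩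
    rw [siteR, siteR, dif_pos h, dif_pos h.symm, twoSite_swap hcom, ← twoSite_mul hcom, hc,
      twoSite_smul_one]
  · exact ⟨1, by simp [siteR, h, and_comm (a := j < N)]⟩

lemma ptr_embFst_mul_monodromy
    (hP : ∀ (n : Fin N) (lam : ℂ) (i j k l : Fin (d n)),
      R n n lam lam (i, j) (k, l) = if i = l ∧ j = k then 1 else 0)
    (n : Fin N) (E : Matrix (Fin (d n)) (Fin (d n)) ℂ) :
    ptr (embFst E * monodromy d ξ R n (ξ n)) =
      descProd (siteR d ξ R n) 0 n * embSite d n E *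
        descProd (siteR d ξ R n) (n + 1) (N - (n + 1)) := by
  set G : ℕ → Matrix (Fin (d n)) (Fin (d n)) (Matrix (∀ j, Fin (d j)) (∀ j, Fin (d j)) ℂ) :=
    fun k => if h : k < N then auxBlock (siteHom d ⟨k, h⟩) (R n ⟨k, h⟩ (ξ n) (ξ ⟨k, h⟩)) else 1
    with hG
  have hGn : G n = auxPerm (siteHom d n) := by
    simpa [hG] using auxBlock_eq_auxPerm _ (hP n (ξ n))
  have hmon : monodromy d ξ R n (ξ n) = compRingEquiv _ _ ℂ
      (descProd G (n + 1) (N - (n + 1)) * (auxPerm (siteHom d n) * descProd G 0 n)) := by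
    have hsplit : descProd G 0 N =
        descProd G (n + 1) (N - (n + 1)) * (auxPerm (siteHom d n) * descProd G 0 n) := by
      have := descProd_add G 0 (n + 1) (N - (n + 1))
      rwa [Nat.add_sub_cancel' n.isLt, descProd, zero_add, zero_add, hGn] at this
    rw [← hsplit, monodromy, prod_reverse_ofFn]
    rw [map_descProd]
    refine descProd_congr fun k _ hk => ?_
    rw [zero_add] at hk
    simp only [hG, dif_pos hk]
    exact (compRingEquiv_auxBlock d n ⟨k, hk⟩ _).symm
  have hsite {k : ℕ} (hk : k < N) : siteR d ξ R n k =
      twoSite (siteHom d n) (siteHom d ⟨k, hk⟩) (R n ⟨k, hk⟩ (ξ n) (ξ ⟨k, hk⟩)) := by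
    rw [siteR, dif_pos ⟨n.isLt, hk⟩]
  have hcom {k : ℕ} (hk : k < N) (hkn : k ≠ n) :=
    siteHom_commute d (m := n) (n := ⟨k, hk⟩) (Fin.ne_of_val_ne hkn.symm)
  rw [hmon, ← compRingEquiv_map_algebraMap, ← map_mul, ptr_compRingEquiv]
  refine trace_map_mul_monodromy (φ := siteHom d n) E ?_ ?_
    (Commute.descProd_right fun k hk hkN => ?_)
  · rw [map_descProd]
    refine SemiconjBy.descProd fun k _ hk => ?_
    have hkN : k < N := by omega
    simp only [hG, dif_pos hkN, hsite hkN]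
    exact auxPerm_semiconjBy_auxBlock (hcom hkN (by omega)) _
  · rw [map_descProd]
    refine SemiconjBy.descProd fun k hk hk' => ?_
    have hkN : k < N := by omega
    simp only [hG, dif_pos hkN, hsite hkN]
    exact auxPerm_semiconjBy_scalar (hcom hkN (by omega)) _
  · have hkN : k < N := by omega
    simp only [hG, dif_pos hkN]
    exact scalar_commute_of_entries fun a b => (Commute.descProd_right fun i _ hi =>
      siteHom_commute_siteR (n := ⟨k, hkN⟩) (show (n : ℕ) ≠ k by omega)
        (show i ≠ k by omega) _).symm

lemma transfer_eq_cyclicProd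
    (hP : ∀ (n : Fin N) (lam : ℂ) (i j k l : Fin (d n)),
      R n n lam lam (i, j) (k, l) = if i = l ∧ j = k then 1 else 0)
    (n : Fin N) : transfer d ξ R n (ξ n) = cyclicProd N (siteR d ξ R) n := by
  have h := ptr_embFst_mul_monodromy (ξ := ξ) hP n 1
  have h1 : embFst (H := ∀ j, Fin (d j)) (1 : Matrix (Fin (d n)) (Fin (d n)) ℂ) = 1 := by
    rw [← compRingEquiv_map_algebraMap, Matrix.map_one _ (map_zero _) (map_one _), map_one]
  have h2 : embSite d n 1 = 1 := map_one (siteHom d n)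
  rwa [h1, h2, one_mul, mul_one] at h

lemma prod_ofFn_transfer
    (hP : ∀ (n : Fin N) (lam : ℂ) (i j k l : Fin (d n)),
      R n n lam lam (i, j) (k, l) = if i = l ∧ j = k then 1 else 0)
    {k : ℕ} (hk : k ≤ N) :
    (List.ofFn fun i : Fin k => transfer d ξ R (Fin.castLE hk i) (ξ (Fin.castLE hk i))).prod =
      ((List.range k).map (cyclicProd N (siteR d ξ R))).prod := by
  induction k with
  | zero => simp
  | succ k ih =>
    rw [List.ofFn_succ_last, List.prod_append, List.prod_range_succ, ← ih (by omega),
      List.prod_singleton, transfer_eq_cyclicProd hP]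
    rfl

end Chain

/-- general solution of the quantum inverse scattering problem:
for any site `n` and any operator `E` on `W_n`,
`E_n = (∏_{i=1}^{n−1} t⁽ⁱ⁾(ξ_i)) · tr₀(E₀ · T⁽ⁿ⁾₀(ξ_n)) · (∏_{i=1}^{n} t⁽ⁱ⁾(ξ_i))⁻¹`,
assuming the Yang–Baxter equation, the initial condition `R^{mn}(λ,λ) = P` whenever
`d_m = d_n`, and invertibility of the transfer matrices `t⁽ⁱ⁾(ξ_i)`, `1 ≤ i ≤ n`. -/
theorem general_inverse_problem (d : Fin N → ℕ) (ξ : Fin N → ℂ)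
    (R : ∀ m n : Fin N, ℂ → ℂ → Matrix (Fin (d m) × Fin (d n)) (Fin (d m) × Fin (d n)) ℂ)
    (hYB : ∀ (m n p : Fin N) (lam mu nu : ℂ),
      e12 (γ := Fin (d p)) (R m n lam mu) * e13 (β := Fin (d n)) (R m p lam nu) *
          e23 (α := Fin (d m)) (R n p mu nu) =
        e23 (α := Fin (d m)) (R n p mu nu) * e13 (β := Fin (d n)) (R m p lam nu) *
          e12 (γ := Fin (d p)) (R m n lam mu))
    (hP : ∀ (m n : Fin N) (lam : ℂ), d m = d n →
      ∀ (i k : Fin (d m)) (j l : Fin (d n)),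
        R m n lam lam (i, j) (k, l) =
          if (i : ℕ) = (l : ℕ) ∧ (j : ℕ) = (k : ℕ) then 1 else 0)
    (n : Fin N)
    (hInv : ∀ i : Fin N, i ≤ n → IsUnit (transfer d ξ R i (ξ i)))
    (E : Matrix (Fin (d n)) (Fin (d n)) ℂ) :
    embSite d n E =
      (List.ofFn fun i : Fin n.val =>
          transfer d ξ R (Fin.castLE n.isLt.le i) (ξ (Fin.castLE n.isLt.le i))).prod *
      ptr (embFst E * monodromy d ξ R n (ξ n)) *
      ((List.ofFn fun i : Fin (n.val + 1) =>
          transfer d ξ R (Fin.castLE n.isLt i) (ξ (Fin.castLE n.isLt i))).prod)⁻¹ := by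
  have hP' (m : Fin N) (lam : ℂ) (i j k l : Fin (d m)) :
      R m m lam lam (i, j) (k, l) = if i = l ∧ j = k then 1 else 0 := by
    simp only [hP m m lam rfl, Fin.ext_iff]
  have hcomm : Commute (embSite d n E) _ := commute_prod_cyclicProd_mul n.isLt
    (fun _ _ => siteR_mul_siteR_swap (ξ := ξ) hYB hP')
    (fun _ _ _ _ => siteR_commute) (fun _ _ hi hj => siteHom_commute_siteR hi hj E)
  have hunit : IsUnit ((List.ofFn fun i : Fin (n.val + 1) =>
      transfer d ξ R (Fin.castLE n.isLt i) (ξ (Fin.castLE n.isLt i))).prod) := by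
    refine List.prod_isUnit fun t ht => ?_
    obtain ⟨i, rfl⟩ := (List.mem_ofFn' _ _).1 ht
    exact hInv _ (Fin.le_def.2 (Nat.lt_succ_iff.1 i.isLt))
  have hmain : ∀ S : Matrix (∀ j, Fin (d j)) (∀ j, Fin (d j)) ℂ, IsUnit S →
      ∀ T, embSite d n E * S = T → embSite d n E = T * S⁻¹ := by
    rintro S hS _ rfl
    rw [mul_nonsing_inv_cancel_right _ _ ((isUnit_iff_isUnit_det S).1 hS)]
  refine hmain _ hunit _ ?_
  rw [prod_ofFn_transfer hP', prod_ofFn_transfer hP', ptr_embFst_mul_monodromy hP',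
    List.prod_range_succ, cyclicProd, ← mul_assoc, ← mul_assoc, ← mul_assoc, ← mul_assoc]
  exact congrArg (· * _) (((mul_assoc _ _ _).trans hcomm.eq))
end
end

section
/- Suppose additionally given an auxiliary space W' = ℂ^{d'} and, for each site index n, operators R'^{n}(λ,μ) on W' ⊗ W_n such that for all m,n and all λ,μ,ν ∈ ℂ the Yang–Baxter equation R^{mn}_{23}(μ,ν) R'^{n}_{13}(λ,ν) R'^{m}_{12}(λ,μ) = R'^{m}_{12}(λ,μ) R'^{n}_{13}(λ,ν) R^{mn}_{23}(μ,ν) holds on W' ⊗ W_m ⊗ W_n. For 1 ≤ k ≤ N define the shifted monodromy matrix T'_{0';k}(λ) = R'^{k−1}_{0',k−1}(λ,ξ_{k−1}) ⋯ R'^{1}_{0',1}(λ,ξ_1) · R'^{N}_{0',N}(λ,ξ_N) ⋯ R'^{k}_{0',k}(λ,ξ_k) on W' ⊗ H (so T'_{0';1}(λ) = R'^{N}_{0',N}(λ,ξ_N) ⋯ R'^{1}_{0',1}(λ,ξ_1)). Then for every 1 ≤ n ≤ N and every λ ∈ ℂ, the product T_{1→n} = ∏_{i=1}^{n−1} t^{(i)}(ξ_i)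 satisfies T_{1→n} · T'_{0';1}(λ) = T'_{0';n}(λ) · T_{1→n}; in particular, if each t^{(i)}(ξ_i) is invertible then T_{1→n} is an invertible operator conjugating the monodromy matrix to its cyclic shift from site 1 to site n. -/
open Matrix

noncomputable section

variable {N : ℕ}

/-- Embedding of an operator on W'(aux) ⊗ W_i into W' ⊗ H, acting on the auxiliary
leg and the `i`-th site. -/
def embAux' (d : Fin N → ℕ) (d' : ℕ) (i : Fin N)
    (M : Matrix (Fin d' × Fin (d i)) (Fin d' × Fin (d i)) ℂ) :
    Matrix (Fin d' × (∀ j, Fin (d j))) (Fin d' × (∀ j, Fin (d j))) ℂ :=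
  Matrix.of fun p q =>
    M (p.1, p.2 i) (q.1, q.2 i) *
      ∏ j : Fin N, if j = i then 1 else (if p.2 j = q.2 j then 1 else 0)

/-- The shifted monodromy matrix
`T'_{0';k}(λ) = R'_{0',k−1}(λ,ξ_{k−1}) ⋯ R'_{0',1}(λ,ξ_1) · R'_{0',N}(λ,ξ_N) ⋯ R'_{0',k}(λ,ξ_k)`
(with `k` here 0-indexed: `monoCyc k` is the monodromy matrix whose rightmost factor
sits at site `k`, the sites being ordered cyclically). -/
def monoCyc (d : Fin N → ℕ) (ξ : Fin N → ℂ) (d' : ℕ)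
    (R' : ∀ i : Fin N, ℂ → ℂ → Matrix (Fin d' × Fin (d i)) (Fin d' × Fin (d i)) ℂ)
    (k : Fin N) (lam : ℂ) :
    Matrix (Fin d' × (∀ j, Fin (d j))) (Fin d' × (∀ j, Fin (d j))) ℂ :=
  ((List.ofFn fun j : Fin N =>
      embAux' d d' (k + j) (R' (k + j) lam (ξ (k + j)))).reverse).prod

/-- `Id ⊗ M` on W' ⊗ H. -/
def idOtimes {H : Type*} (d' : ℕ) (M : Matrix H H ℂ) :
    Matrix (Fin d' × H) (Fin d' × H) ℂ :=
  Matrix.of fun p q => (if p.1 = q.1 then (1 : ℂ) else 0) * M p.2 q.2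

open scoped Kronecker

namespace ShiftOperator

section Legs

variable {α β γ A : Type*} [Fintype α] [DecidableEq α] [Fintype β] [DecidableEq β]
  [Fintype γ] [DecidableEq γ] [Ring A] [Algebra ℂ A]

theorem kronecker_induction {p : Matrix (α × β) (α × β) ℂ → Prop} (zero : p 0)
    (kron : ∀ (X : Matrix α α ℂ) (Y : Matrix β β ℂ), p (X ⊗ₖ Y))
    (plus : ∀ X Y, p X → p Y → p (X + Y)) (M : Matrix (α × β) (α × β) ℂ) : p M := by
  obtain ⟨t, rfl⟩ := (kroneckerLinearEquiv α α β β ℂ).surjective M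
  induction t using TensorProduct.induction_on with
  | zero => simpa using zero
  | tmul X Y => simpa using kron X Y
  | add X Y hX hY => simpa using plus _ _ hX hY

/-- The linear map sending `X ⊗ₖ Y` to `f X * g Y`. -/
def pair (f : Matrix α α ℂ →ₗ[ℂ] A) (g : Matrix β β ℂ →ₗ[ℂ] A) :
    Matrix (α × β) (α × β) ℂ →ₗ[ℂ] A :=
  (LinearMap.mul' ℂ A ∘ₗ TensorProduct.map f g) ∘ₗ
    (kroneckerLinearEquiv α α β β ℂ).symm.toLinearMap

@[simp]
theorem pair_kronecker (f : Matrix α α ℂ →ₗ[ℂ] A) (g : Matrix β β ℂ →ₗ[ℂ] A)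
    (X : Matrix α α ℂ) (Y : Matrix β β ℂ) : pair f g (X ⊗ₖ Y) = f X * g Y := by
  simp [pair]

theorem pair_mul {f : Matrix α α ℂ →ₗ[ℂ] A} {g : Matrix β β ℂ →ₗ[ℂ] A}
    (hf : ∀ X Y, f (X * Y) = f X * f Y) (hg : ∀ X Y, g (X * Y) = g X * g Y)
    (hfg : ∀ X Y, Commute (f X) (g Y)) (M M' : Matrix (α × β) (α × β) ℂ) :
    pair f g (M * M') = pair f g M * pair f g M' := by
  induction M using kronecker_induction with
  | zero => simp
  | plus X Y hX hY => simp [add_mul, hX, hY]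
  | kron X Y =>
    induction M' using kronecker_induction with
    | zero => simp
    | plus X Y hX hY => simp [mul_add, hX, hY]
    | kron X' Y' =>
      rw [← mul_kronecker_mul, pair_kronecker, pair_kronecker, pair_kronecker, hf, hg,
        (hfg X' Y).mul_mul_mul_comm]

theorem commute_pair {f : Matrix α α ℂ →ₗ[ℂ] A} {g : Matrix β β ℂ →ₗ[ℂ] A} {a : A}
    (hf : ∀ X, Commute a (f X)) (hg : ∀ Y, Commute a (g Y)) (M : Matrix (α × β) (α × β) ℂ) :
    Commute a (pair f g M) := by
  induction M using kronecker_induction with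
  | zero => simp
  | plus X Y hX hY => simpa using hX.add_right hY
  | kron X Y => simpa using (hf X).mul_right (hg Y)

theorem map_pair {B : Type*} [Ring B] [Algebra ℂ B] (φ : A →ₐ[ℂ] B)
    (f : Matrix α α ℂ →ₗ[ℂ] A) (g : Matrix β β ℂ →ₗ[ℂ] A) (M : Matrix (α × β) (α × β) ℂ) :
    φ (pair f g M) = pair (φ.toLinearMap ∘ₗ f) (φ.toLinearMap ∘ₗ g) M := by
  induction M using kronecker_induction with
  | zero => simp
  | plus X Y hX hY => simp [hX, hY]
  | kron X Y => simp

variable (f : Matrix α α ℂ →ₐ[ℂ] A) (g : Matrix β β ℂ →ₐ[ℂ] A) (h : Matrix γ γ ℂ →ₐ[ℂ] A)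

/-- The linear map sending `X ⊗ₖ Y ⊗ₖ Z` to `f X * g Y * h Z`. -/
def triple : Matrix (α × β × γ) (α × β × γ) ℂ →ₗ[ℂ] A :=
  pair f.toLinearMap (pair g.toLinearMap h.toLinearMap)

theorem triple_e12 (M : Matrix (α × β) (α × β) ℂ) :
    triple f g h (e12 M) = pair f.toLinearMap g.toLinearMap M := by
  induction M using kronecker_induction with
  | zero =>
    have : e12 (0 : Matrix (α × β) (α × β) ℂ) = (0 : Matrix (α × β × γ) _ ℂ) := by
      ext; simp [e12]
    simp [this]
  | plus X Y hX hY =>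
    have : (e12 (X + Y) : Matrix (α × β × γ) _ ℂ) = e12 X + e12 Y := by
      ext; simp only [e12, of_apply, Matrix.add_apply, add_mul]
    simp [this, hX, hY]
  | kron X Y =>
    have : (e12 (X ⊗ₖ Y) : Matrix (α × β × γ) _ ℂ) = X ⊗ₖ (Y ⊗ₖ (1 : Matrix γ γ ℂ)) := by
      ext; simp [e12, one_apply]
    simp [this, triple]

theorem triple_e13 (M : Matrix (α × γ) (α × γ) ℂ) :
    triple f g h (e13 M) = pair f.toLinearMap h.toLinearMap M := by
  induction M using kronecker_induction with
  | zero =>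
    have : e13 (0 : Matrix (α × γ) (α × γ) ℂ) = (0 : Matrix (α × β × γ) _ ℂ) := by
      ext; simp [e13]
    simp [this]
  | plus X Y hX hY =>
    have : (e13 (X + Y) : Matrix (α × β × γ) _ ℂ) = e13 X + e13 Y := by
      ext; simp only [e13, of_apply, Matrix.add_apply, add_mul]
    simp [this, hX, hY]
  | kron X Y =>
    have : (e13 (X ⊗ₖ Y) : Matrix (α × β × γ) _ ℂ) = X ⊗ₖ ((1 : Matrix β β ℂ) ⊗ₖ Y) := by
      ext; simp [e13, one_apply]
    simp [this, triple]

theorem triple_e23 (M : Matrix (β × γ) (β × γ) ℂ) :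
    triple f g h (e23 M) = pair g.toLinearMap h.toLinearMap M := by
  have : (e23 M : Matrix (α × β × γ) _ ℂ) = (1 : Matrix α α ℂ) ⊗ₖ M := by
    ext; simp [e23, one_apply]
  simp [this, triple]

variable {f g h}

theorem triple_mul (hfg : ∀ X Y, Commute (f X) (g Y)) (hfh : ∀ X Y, Commute (f X) (h Y))
    (hgh : ∀ X Y, Commute (g X) (h Y)) (M M' : Matrix (α × β × γ) (α × β × γ) ℂ) :
    triple f g h (M * M') = triple f g h M * triple f g h M' :=
  pair_mul (by simp) (pair_mul (by simp) (by simp) hgh)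
    (fun X => commute_pair (hfg X) (hfh X)) M M'

theorem pair_yangBaxter (hfg : ∀ X Y, Commute (f X) (g Y)) (hfh : ∀ X Y, Commute (f X) (h Y))
    (hgh : ∀ X Y, Commute (g X) (h Y)) {K : Matrix (β × γ) (β × γ) ℂ}
    {L : Matrix (α × γ) (α × γ) ℂ} {M : Matrix (α × β) (α × β) ℂ}
    (H : e23 (α := α) K * e13 (β := β) L * e12 (γ := γ) M =
      e12 (γ := γ) M * e13 (β := β) L * e23 (α := α) K) :
    pair g.toLinearMap h.toLinearMap K * pair f.toLinearMap h.toLinearMap L *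
        pair f.toLinearMap g.toLinearMap M =
      pair f.toLinearMap g.toLinearMap M * pair f.toLinearMap h.toLinearMap L *
        pair g.toLinearMap h.toLinearMap K := by
  simpa only [triple_mul hfg hfh hgh, triple_e12, triple_e13, triple_e23] using
    congrArg (triple f g h) H

end Legs

section Sites

variable (d : Fin N → ℕ)

/-- The tensor product of one operator per site, as an operator on `H`. -/
def piKronecker : (∀ j, Matrix (Fin (d j)) (Fin (d j)) ℂ) →*
    Matrix (∀ j, Fin (d j)) (∀ j, Fin (d j)) ℂ where
  toFun C := of fun x y => ∏ j, C j (x j) (y j)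
  map_one' := by
    ext x y
    rw [of_apply, one_apply]
    split_ifs with h
    · subst h
      exact Finset.prod_eq_one fun j _ => one_apply_eq (x j)
    · obtain ⟨j, hj⟩ := Function.ne_iff.mp h
      exact Finset.prod_eq_zero (Finset.mem_univ j) (one_apply_ne hj)
  map_mul' C D := by
    ext x y
    simp [mul_apply, Fintype.prod_sum, Finset.prod_mul_distrib]

theorem piKronecker_mulSingle (i : Fin N) (E : Matrix (Fin (d i)) (Fin (d i)) ℂ) :
    piKronecker d (Pi.mulSingle i E) = embSite d i E := by
  ext x y
  have h : ∀ C : ∀ j, Matrix (Fin (d j)) (Fin (d j)) ℂ,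
      piKronecker d C x y = ∏ j, C j (x j) (y j) := fun _ => rfl
  rw [h, embSite, of_apply, ← Finset.mul_prod_erase _ _ (Finset.mem_univ i),
    ← Finset.mul_prod_erase _ (fun j => if j = i then _ else _) (Finset.mem_univ i)]
  simp only [Pi.mulSingle_eq_same, if_true, one_mul]
  congr 1
  refine Finset.prod_congr rfl fun j hj => ?_
  have hj := Finset.ne_of_mem_erase hj
  simp [hj, one_apply]

/-- `embSite` as an algebra homomorphism. -/
def siteHom (i : Fin N) : Matrix (Fin (d i)) (Fin (d i)) ℂ →ₐ[ℂ]
    Matrix (∀ j, Fin (d j)) (∀ j, Fin (d j)) ℂ :=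
  AlgHom.ofLinearMap
    { toFun := embSite d i
      map_add' := fun X Y => by ext; simp [embSite, add_mul]
      map_smul' := fun c X => by ext; simp [embSite, mul_assoc] }
    (by
      change embSite d i 1 = 1
      rw [← piKronecker_mulSingle, Pi.mulSingle_one, map_one])
    (fun X Y => by
      change embSite d i (X * Y) = embSite d i X * embSite d i Y
      simp only [← piKronecker_mulSingle]
      rw [Pi.mulSingle_mul, map_mul])

theorem siteHom_apply (i : Fin N) (E : Matrix (Fin (d i)) (Fin (d i)) ℂ) :
    siteHom d i E = embSite d i E := rfl

theorem siteHom_commute {i j : Fin N} (hij : i ≠ j) (X : Matrix (Fin (d i)) (Fin (d i)) ℂ)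
    (Y : Matrix (Fin (d j)) (Fin (d j)) ℂ) : Commute (siteHom d i X) (siteHom d j Y) := by
  rw [siteHom_apply, siteHom_apply, ← piKronecker_mulSingle, ← piKronecker_mulSingle]
  have h := Pi.mulSingle_commute (f := fun j => Matrix (Fin (d j)) (Fin (d j)) ℂ) hij X Y
  exact h.map (piKronecker d)

/-- The operator `M` acting on the sites `i` and `j`. -/
def sitePair (i j : Fin N) (M : Matrix (Fin (d i) × Fin (d j)) (Fin (d i) × Fin (d j)) ℂ) :
    Matrix (∀ j, Fin (d j)) (∀ j, Fin (d j)) ℂ :=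
  pair (siteHom d i).toLinearMap (siteHom d j).toLinearMap M

end Sites

section Auxiliary

theorem ptr_add {α H : Type*} [Fintype α] (X Y : Matrix (α × H) (α × H) ℂ) :
    ptr (X + Y) = ptr X + ptr Y := by
  ext; simp [ptr, Finset.sum_add_distrib]

variable {H : Type*} [Fintype H] [DecidableEq H] (a : ℕ)

/-- `X ↦ X ⊗ Id`. -/
def fstHom : Matrix (Fin a) (Fin a) ℂ →ₐ[ℂ] Matrix (Fin a × H) (Fin a × H) ℂ :=
  AlgHom.ofLinearMap
    { toFun := fun X => X ⊗ₖ (1 : Matrix H H ℂ)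
      map_add' := fun X Y => add_kronecker X Y 1
      map_smul' := fun c X => smul_kronecker c X 1 }
    (by simp) (fun X Y => by simp [← mul_kronecker_mul])

/-- `idOtimes` as an algebra homomorphism. -/
def sndHom : Matrix H H ℂ →ₐ[ℂ] Matrix (Fin a × H) (Fin a × H) ℂ :=
  AlgHom.ofLinearMap
    { toFun := fun X => (1 : Matrix (Fin a) (Fin a) ℂ) ⊗ₖ X
      map_add' := fun X Y => kronecker_add 1 X Y
      map_smul' := fun c X => kronecker_smul c 1 X }
    (by simp) (fun X Y => by simp [← mul_kronecker_mul])

theorem fstHom_apply (X : Matrix (Fin a) (Fin a) ℂ) :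
    fstHom (H := H) a X = X ⊗ₖ (1 : Matrix H H ℂ) := rfl

theorem sndHom_apply (X : Matrix H H ℂ) :
    sndHom a X = (1 : Matrix (Fin a) (Fin a) ℂ) ⊗ₖ X := rfl

theorem sndHom_eq_idOtimes (X : Matrix H H ℂ) : sndHom a X = idOtimes a X := by
  ext; simp [sndHom_apply, idOtimes, one_apply]

theorem fstHom_commute_sndHom (X : Matrix (Fin a) (Fin a) ℂ) (Y : Matrix H H ℂ) :
    Commute (fstHom a X) (sndHom a Y) := by
  simp [Commute, SemiconjBy, fstHom_apply, sndHom_apply, ← mul_kronecker_mul]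

variable {a}

theorem ptr_sndHom_mul (Z : Matrix H H ℂ) (Y : Matrix (Fin a × H) (Fin a × H) ℂ) :
    ptr (sndHom a Z * Y) = Z * ptr Y := by
  ext x y
  simp only [ptr, sndHom_apply, mul_apply, of_apply, Fintype.sum_prod_type, kronecker_apply,
    one_apply, ite_mul, one_mul, zero_mul, Finset.mul_sum]
  rw [Finset.sum_comm]
  simp [Finset.sum_ite_irrel]
  exact Finset.sum_comm

theorem ptr_mul_sndHom (Y : Matrix (Fin a × H) (Fin a × H) ℂ) (Z : Matrix H H ℂ) :
    ptr (Y * sndHom a Z) = ptr Y * Z := by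
  ext x y
  simp only [ptr, sndHom_apply, mul_apply, of_apply, Fintype.sum_prod_type, kronecker_apply,
    one_apply, ite_mul, one_mul, zero_mul, Finset.sum_mul]
  rw [Finset.sum_comm]
  simp [Finset.sum_ite_irrel]
  exact Finset.sum_comm

theorem ptr_fstHom_mul_comm (X : Matrix (Fin a) (Fin a) ℂ)
    (Y : Matrix (Fin a × H) (Fin a × H) ℂ) : ptr (fstHom a X * Y) = ptr (Y * fstHom a X) := by
  ext x y
  simp [ptr, fstHom_apply, mul_apply, Fintype.sum_prod_type, one_apply]
  rw [Finset.sum_comm]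
  exact Finset.sum_congr rfl fun _ _ => Finset.sum_congr rfl fun _ _ => mul_comm _ _

end Auxiliary

section AuxSite

variable (d : Fin N → ℕ) (a : ℕ)

/-- The operators on the `i`-th site, acting on (auxiliary space) ⊗ `H`. -/
def auxSiteHom (i : Fin N) : Matrix (Fin (d i)) (Fin (d i)) ℂ →ₐ[ℂ]
    Matrix (Fin a × (∀ j, Fin (d j))) (Fin a × (∀ j, Fin (d j))) ℂ :=
  (sndHom a).comp (siteHom d i)

theorem auxSiteHom_commute {i j : Fin N} (hij : i ≠ j) (X : Matrix (Fin (d i)) (Fin (d i)) ℂ)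
    (Y : Matrix (Fin (d j)) (Fin (d j)) ℂ) :
    Commute (auxSiteHom d a i X) (auxSiteHom d a j Y) :=
  (siteHom_commute d hij X Y).map (sndHom a)

theorem fstHom_commute_auxSiteHom (i : Fin N) (X : Matrix (Fin a) (Fin a) ℂ)
    (Y : Matrix (Fin (d i)) (Fin (d i)) ℂ) : Commute (fstHom a X) (auxSiteHom d a i Y) :=
  fstHom_commute_sndHom a X _

theorem embAux'_eq_pair (i : Fin N) (M : Matrix (Fin a × Fin (d i)) (Fin a × Fin (d i)) ℂ) :
    embAux' d a i M = pair (fstHom a).toLinearMap (auxSiteHom d a i).toLinearMap M := by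
  induction M using kronecker_induction with
  | zero => ext; simp [embAux']
  | plus X Y hX hY => rw [map_add, ← hX, ← hY]; ext; simp [embAux', add_mul]
  | kron X Y =>
    simp only [pair_kronecker, AlgHom.toLinearMap_apply, auxSiteHom, AlgHom.comp_apply,
      fstHom_apply, sndHom_apply, ← mul_kronecker_mul, mul_one, one_mul, siteHom_apply]
    ext; simp [embAux', embSite, mul_assoc]

theorem sndHom_sitePair (i j : Fin N)
    (M : Matrix (Fin (d i) × Fin (d j)) (Fin (d i) × Fin (d j)) ℂ) :
    sndHom a (sitePair d i j M) =
      pair (auxSiteHom d a i).toLinearMap (auxSiteHom d a j).toLinearMap M :=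
  map_pair _ _ _ _

variable {d a}

/-- Cyclicity of the partial trace with respect to an operator acting on the auxiliary space
and a site on which the other factor is trivial. -/
theorem ptr_embAux'_mul_comm (i : Fin N) (M : Matrix (Fin a × Fin (d i)) (Fin a × Fin (d i)) ℂ)
    {X : Matrix (Fin a × (∀ j, Fin (d j))) (Fin a × (∀ j, Fin (d j))) ℂ}
    (hX : ∀ E, Commute X (auxSiteHom d a i E)) :
    ptr (embAux' d a i M * X) = ptr (X * embAux' d a i M) := by
  rw [embAux'_eq_pair]
  induction M using kronecker_induction with
  | zero => simp
  | plus Y Z hY hZ => simp [add_mul, mul_add, ptr_add, hY, hZ]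
  | kron Y Z =>
    simp only [pair_kronecker, AlgHom.toLinearMap_apply]
    rw [mul_assoc, ← (hX Z).eq, ← mul_assoc, ← mul_assoc]
    simp only [auxSiteHom, AlgHom.comp_apply, ptr_mul_sndHom, ptr_fstHom_mul_comm]

theorem commute_embAux' {i : Fin N}
    {X : Matrix (Fin a × (∀ j, Fin (d j))) (Fin a × (∀ j, Fin (d j))) ℂ}
    (hfst : ∀ E, Commute X (fstHom a E)) (hsite : ∀ E, Commute X (auxSiteHom d a i E))
    (M : Matrix (Fin a × Fin (d i)) (Fin a × Fin (d i)) ℂ) : Commute X (embAux' d a i M) := by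
  rw [embAux'_eq_pair]
  exact commute_pair hfst hsite M

theorem auxSiteHom_commute_embAux' {i j : Fin N} (hij : i ≠ j)
    (E : Matrix (Fin (d i)) (Fin (d i)) ℂ)
    (M : Matrix (Fin a × Fin (d j)) (Fin a × Fin (d j)) ℂ) :
    Commute (auxSiteHom d a i E) (embAux' d a j M) :=
  commute_embAux' (fun X => (fstHom_commute_auxSiteHom d a i X E).symm)
    (auxSiteHom_commute d a hij E) M

theorem sndHom_sitePair_commute_embAux' {i j k : Fin N} (hik : i ≠ k) (hjk : j ≠ k)
    (K : Matrix (Fin (d i) × Fin (d j)) (Fin (d i) × Fin (d j)) ℂ)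
    (M : Matrix (Fin a × Fin (d k)) (Fin a × Fin (d k)) ℂ) :
    Commute (sndHom a (sitePair d i j K)) (embAux' d a k M) := by
  rw [sndHom_sitePair]
  exact (commute_pair (fun X => (auxSiteHom_commute_embAux' hik X M).symm)
    (fun X => (auxSiteHom_commute_embAux' hjk X M).symm) K).symm

theorem sitePair_yangBaxter {m n : Fin N} (hmn : m ≠ n)
    {K : Matrix (Fin (d m) × Fin (d n)) (Fin (d m) × Fin (d n)) ℂ}
    {L : Matrix (Fin a × Fin (d n)) (Fin a × Fin (d n)) ℂ}
    {M : Matrix (Fin a × Fin (d m)) (Fin a × Fin (d m)) ℂ}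
    (h : e23 (α := Fin a) K * e13 (β := Fin (d m)) L * e12 (γ := Fin (d n)) M =
      e12 (γ := Fin (d n)) M * e13 (β := Fin (d m)) L * e23 (α := Fin a) K) :
    sndHom a (sitePair d m n K) * embAux' d a n L * embAux' d a m M =
      embAux' d a m M * embAux' d a n L * sndHom a (sitePair d m n K) := by
  rw [sndHom_sitePair, embAux'_eq_pair, embAux'_eq_pair]
  exact pair_yangBaxter (fstHom_commute_auxSiteHom d a m) (fstHom_commute_auxSiteHom d a n)
    (auxSiteHom_commute d a hmn) h

section Permutation

variable {i : Fin N} {P : Matrix (Fin (d i) × Fin (d i)) (Fin (d i) × Fin (d i)) ℂ}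

theorem ptr_embAux'_permutation
    (hP : ∀ x y z w, P (x, y) (z, w) = if x = w ∧ y = z then 1 else 0) :
    ptr (embAux' d (d i) i P) = 1 := by
  ext x y
  change ∑ c, P (c, x i) (c, y i) *
    ∏ j, (if j = i then (1 : ℂ) else if x j = y j then 1 else 0) = _
  simp only [hP]
  rw [← Finset.sum_mul]
  have h1 : ∑ c, (if c = y i ∧ x i = c then (1 : ℂ) else 0) =
      (1 : Matrix (Fin (d i)) (Fin (d i)) ℂ) (x i) (y i) := by
    rw [one_apply, Finset.sum_eq_single (y i)]
    · simp
    · intro b _ hb; simp [hb]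
    · simp
  rw [h1]
  have h2 : embSite d i 1 x y = (1 : Matrix (∀ j, Fin (d j)) (∀ j, Fin (d j)) ℂ) x y := by
    rw [← siteHom_apply, map_one]
  simpa [embSite] using h2

theorem fstHom_mul_permutation
    (hP : ∀ x y z w, P (x, y) (z, w) = if x = w ∧ y = z then 1 else 0)
    (X : Matrix (Fin (d i)) (Fin (d i)) ℂ) :
    fstHom (d i) X * embAux' d (d i) i P =
      embAux' d (d i) i P * auxSiteHom d (d i) i X := by
  rw [embAux'_eq_pair]
  have h : (X ⊗ₖ (1 : Matrix (Fin (d i)) (Fin (d i)) ℂ)) * P =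
      P * ((1 : Matrix (Fin (d i)) (Fin (d i)) ℂ) ⊗ₖ X) := by
    ext ⟨x, y⟩ ⟨z, w⟩
    simp [mul_apply, Fintype.sum_prod_type, hP, one_apply, ite_and]
  simpa [pair_mul (f := (fstHom (d i)).toLinearMap) (g := (auxSiteHom d (d i) i).toLinearMap)
    (by simp) (by simp) (fstHom_commute_auxSiteHom d (d i) i)] using
    congrArg (pair (fstHom (d i)).toLinearMap (auxSiteHom d (d i) i).toLinearMap) h

theorem embAux'_mul_permutation
    (hP : ∀ x y z w, P (x, y) (z, w) = if x = w ∧ y = z then 1 else 0)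
    {j : Fin N} (hij : i ≠ j) (M : Matrix (Fin (d i) × Fin (d j)) (Fin (d i) × Fin (d j)) ℂ) :
    embAux' d (d i) j M * embAux' d (d i) i P =
      embAux' d (d i) i P * sndHom (d i) (sitePair d i j M) := by
  rw [sndHom_sitePair, embAux'_eq_pair (i := j)]
  induction M using kronecker_induction with
  | zero => simp
  | plus X Y hX hY => simp [add_mul, mul_add, hX, hY]
  | kron X Y =>
    simp only [pair_kronecker, AlgHom.toLinearMap_apply]
    rw [mul_assoc, (auxSiteHom_commute_embAux' hij.symm Y P).eq, ← mul_assoc,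
      fstHom_mul_permutation hP, mul_assoc]

end Permutation

end AuxSite

section Lists

variable {ι A : Type*} [Monoid A]

theorem prod_map_exchange {ρ g : ι → A} {x : A} : ∀ {l : List ι}, l.Nodup →
    (∀ j ∈ l, ρ j * g j * x = x * g j * ρ j) →
    (∀ i ∈ l, ∀ j ∈ l, i ≠ j → Commute (ρ i) (g j)) →
    (l.map ρ).prod * (l.map g).prod * x = x * (l.map g).prod * (l.map ρ).prod
  | [], _, _, _ => by simp
  | a :: l, hl, hx, hc => by
    have hal : ∀ j ∈ l, a ≠ j := fun j hj h => (List.nodup_cons.mp hl).1 (h ▸ hj)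
    have h1 : Commute (l.map ρ).prod (g a) := by
      refine Commute.list_prod_left _ _ fun y hy => ?_
      obtain ⟨j, hj, rfl⟩ := List.mem_map.mp hy
      exact hc j (by simp [hj]) a (by simp) (hal j hj).symm
    have h2 : Commute (ρ a) (l.map g).prod := by
      refine Commute.list_prod_right _ _ fun y hy => ?_
      obtain ⟨j, hj, rfl⟩ := List.mem_map.mp hy
      exact hc a (by simp) j (by simp [hj]) (hal j hj)
    have ih := prod_map_exchange (l := l) (ρ := ρ) (g := g) (x := x) (List.nodup_cons.mp hl).2
      (fun j hj => hx j (by simp [hj]))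
      (fun i hi j hj => hc i (by simp [hi]) j (by simp [hj]))
    simp only [List.map_cons, List.prod_cons]
    calc ρ a * (l.map ρ).prod * (g a * (l.map g).prod) * x
        = ρ a * ((l.map ρ).prod * g a) * (l.map g).prod * x := by simp only [mul_assoc]
      _ = ρ a * g a * ((l.map ρ).prod * (l.map g).prod * x) := by
          rw [h1.eq]; simp only [mul_assoc]
      _ = ρ a * g a * x * (l.map g).prod * (l.map ρ).prod := by rw [ih]; simp only [mul_assoc]
      _ = x * g a * (ρ a * (l.map g).prod) * (l.map ρ).prod := by
          rw [hx a (by simp)]; simp only [mul_assoc]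
      _ = x * (g a * (l.map g).prod) * (ρ a * (l.map ρ).prod) := by
          rw [h2.eq]; simp only [mul_assoc]

theorem prod_map_semiconj {ρ g : ι → A} {x : A} : ∀ {l : List ι},
    (∀ j ∈ l, g j * x = x * ρ j) → (l.map g).prod * x = x * (l.map ρ).prod
  | [], _ => by simp
  | a :: l, h => by
    rw [List.map_cons, List.prod_cons, mul_assoc,
      prod_map_semiconj fun j hj => h j (by simp [hj]), ← mul_assoc, h a (by simp), mul_assoc,
      List.map_cons, List.prod_cons]

end Lists

section Cyclic

variable {M : ℕ}

/-- The sites other than `k`, in the order `k - 1, k - 2, …, k + 1`. -/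
def otherSites (k : Fin (M + 1)) : List (Fin (M + 1)) :=
  (List.ofFn fun j : Fin M => k + j.succ).reverse

theorem nodup_otherSites (k : Fin (M + 1)) : (otherSites k).Nodup :=
  List.nodup_reverse.mpr <| List.nodup_ofFn.mpr fun _ _ h =>
    Fin.succ_injective _ (add_left_cancel h)

theorem ne_of_mem_otherSites {k j : Fin (M + 1)} (h : j ∈ otherSites k) : k ≠ j := by
  simp only [otherSites, List.mem_reverse, List.mem_ofFn] at h
  obtain ⟨l, rfl⟩ := h
  simp [Fin.succ_ne_zero]

variable {A : Type*} [Monoid A]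

theorem prod_reverse_ofFn_add (g : Fin (M + 1) → A) (k : Fin (M + 1)) :
    (List.ofFn fun j => g (k + j)).reverse.prod = ((otherSites k).map g).prod * g k := by
  simp [otherSites, List.ofFn_succ, List.map_ofFn, Function.comp_def]

theorem prod_reverse_ofFn_add_one (g : Fin (M + 1) → A) (k : Fin (M + 1)) :
    (List.ofFn fun j => g (k + 1 + j)).reverse.prod = g k * ((otherSites k).map g).prod := by
  rw [List.ofFn_succ_last]
  have h : ∀ j : Fin M, k + 1 + j.castSucc = k + j.succ := fun j => by
    rw [add_assoc, add_comm 1, Fin.coeSucc_eq_succ]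
  have h' : k + 1 + Fin.last M = k := by
    rw [add_assoc, add_comm 1, Fin.last_add_one, add_zero]
  simp [otherSites, h, h', List.map_ofFn, Function.comp_def]

end Cyclic

section Transfer

variable {M : ℕ} {d : Fin (M + 1) → ℕ} {ξ : Fin (M + 1) → ℂ}
  {R : ∀ m n : Fin (M + 1), ℂ → ℂ → Matrix (Fin (d m) × Fin (d n)) (Fin (d m) × Fin (d n)) ℂ}
  {a : ℕ} {S : ∀ i : Fin (M + 1), ℂ → ℂ → Matrix (Fin a × Fin (d i)) (Fin a × Fin (d i)) ℂ}

theorem monoCyc_eq (k : Fin (M + 1)) (lam : ℂ) :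
    monoCyc d ξ a S k lam =
      ((otherSites k).map fun j => embAux' d a j (S j lam (ξ j))).prod *
        embAux' d a k (S k lam (ξ k)) :=
  prod_reverse_ofFn_add (fun j => embAux' d a j (S j lam (ξ j))) k

theorem monoCyc_add_one (k : Fin (M + 1)) (lam : ℂ) :
    monoCyc d ξ a S (k + 1) lam =
      embAux' d a k (S k lam (ξ k)) *
        ((otherSites k).map fun j => embAux' d a j (S j lam (ξ j))).prod :=
  prod_reverse_ofFn_add_one (fun j => embAux' d a j (S j lam (ξ j))) k

theorem ptr_monoCyc_add_one (k : Fin (M + 1)) (lam : ℂ) :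
    ptr (monoCyc d ξ a S (k + 1) lam) = ptr (monoCyc d ξ a S k lam) := by
  rw [monoCyc_add_one, monoCyc_eq]
  refine ptr_embAux'_mul_comm k _ fun E => Commute.list_prod_left _ _ fun y hy => ?_
  obtain ⟨j, hj, rfl⟩ := List.mem_map.mp hy
  exact (auxSiteHom_commute_embAux' (ne_of_mem_otherSites hj) E _).symm

theorem ptr_monoCyc (k : Fin (M + 1)) (lam : ℂ) :
    ptr (monoCyc d ξ a S k lam) = ptr (monoCyc d ξ a S 0 lam) := by
  induction k using Fin.induction with
  | zero => rfl
  | succ k ih => rw [← Fin.coeSucc_eq_succ, ptr_monoCyc_add_one, ih]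

theorem transfer_eq_ptr_monoCyc (n k : Fin (M + 1)) (lam : ℂ) :
    transfer d ξ R n lam = ptr (monoCyc d ξ (d n) (R n) k lam) := by
  rw [ptr_monoCyc]
  have h : (fun j => embAux' d (d n) (0 + j) (R n (0 + j) lam (ξ (0 + j)))) =
      fun j => embAux d n j (R n j lam (ξ j)) :=
    funext fun j => by rw [zero_add]; rfl
  rw [transfer, monodromy, monoCyc, h]

theorem transfer_eq_prod (k : Fin (M + 1))
    (hP : ∀ x y z w, R k k (ξ k) (ξ k) (x, y) (z, w) = if x = w ∧ y = z then 1 else 0) :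
    transfer d ξ R k (ξ k) =
      ((otherSites k).map fun j => sitePair d k j (R k j (ξ k) (ξ j))).prod := by
  rw [transfer_eq_ptr_monoCyc k k, monoCyc_eq,
    prod_map_semiconj (ρ := fun j => sndHom (d k) (sitePair d k j (R k j (ξ k) (ξ j))))
      fun j hj => embAux'_mul_permutation hP (ne_of_mem_otherSites hj) _]
  have h : ((otherSites k).map fun j => sndHom (d k) (sitePair d k j (R k j (ξ k) (ξ j)))).prod =
      sndHom (d k) ((otherSites k).map fun j => sitePair d k j (R k j (ξ k) (ξ j))).prod := by
    rw [map_list_prod, List.map_map]; rfl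
  rw [h, ptr_mul_sndHom, ptr_embAux'_permutation hP, one_mul]

theorem transfer_mul_monoCyc (k : Fin (M + 1))
    (hP : ∀ x y z w, R k k (ξ k) (ξ k) (x, y) (z, w) = if x = w ∧ y = z then 1 else 0)
    (hYB : ∀ (m n : Fin (M + 1)) (lam mu nu : ℂ),
      e23 (α := Fin a) (R m n mu nu) * e13 (β := Fin (d m)) (S n lam nu) *
          e12 (γ := Fin (d n)) (S m lam mu) =
        e12 (γ := Fin (d n)) (S m lam mu) * e13 (β := Fin (d m)) (S n lam nu) *
          e23 (α := Fin a) (R m n mu nu)) (lam : ℂ) :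
    sndHom a (transfer d ξ R k (ξ k)) * monoCyc d ξ a S k lam =
      monoCyc d ξ a S (k + 1) lam * sndHom a (transfer d ξ R k (ξ k)) := by
  rw [transfer_eq_prod k hP, monoCyc_add_one, monoCyc_eq, map_list_prod, List.map_map, ← mul_assoc]
  refine prod_map_exchange (nodup_otherSites k)
    (fun j hj => sitePair_yangBaxter (ne_of_mem_otherSites hj) (hYB k j lam _ _))
    fun i hi j hj hij => sndHom_sitePair_commute_embAux' (ne_of_mem_otherSites hj) hij _ _

theorem transfer_commute
    (hP : ∀ (k : Fin (M + 1)) x y z w,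
      R k k (ξ k) (ξ k) (x, y) (z, w) = if x = w ∧ y = z then 1 else 0)
    (hYB : ∀ (m n p : Fin (M + 1)) (lam mu nu : ℂ),
      e12 (γ := Fin (d p)) (R m n lam mu) * e13 (β := Fin (d n)) (R m p lam nu) *
          e23 (α := Fin (d m)) (R n p mu nu) =
        e23 (α := Fin (d m)) (R n p mu nu) * e13 (β := Fin (d n)) (R m p lam nu) *
          e12 (γ := Fin (d p)) (R m n lam mu)) (k n : Fin (M + 1)) (lam : ℂ) :
    Commute (transfer d ξ R k (ξ k)) (transfer d ξ R n lam) := by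
  have h := congrArg ptr (transfer_mul_monoCyc (S := R n) k (hP k)
    (fun m p lam mu nu => (hYB n m p lam mu nu).symm) lam)
  rwa [ptr_sndHom_mul, ptr_mul_sndHom, ← transfer_eq_ptr_monoCyc,
    ← transfer_eq_ptr_monoCyc] at h

theorem prod_transfer_mul_monoCyc
    (hP : ∀ (k : Fin (M + 1)) x y z w,
      R k k (ξ k) (ξ k) (x, y) (z, w) = if x = w ∧ y = z then 1 else 0)
    (hYB : ∀ (m n p : Fin (M + 1)) (lam mu nu : ℂ),
      e12 (γ := Fin (d p)) (R m n lam mu) * e13 (β := Fin (d n)) (R m p lam nu) *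
          e23 (α := Fin (d m)) (R n p mu nu) =
        e23 (α := Fin (d m)) (R n p mu nu) * e13 (β := Fin (d n)) (R m p lam nu) *
          e12 (γ := Fin (d p)) (R m n lam mu))
    (hYB' : ∀ (m n : Fin (M + 1)) (lam mu nu : ℂ),
      e23 (α := Fin a) (R m n mu nu) * e13 (β := Fin (d m)) (S n lam nu) *
          e12 (γ := Fin (d n)) (S m lam mu) =
        e12 (γ := Fin (d n)) (S m lam mu) * e13 (β := Fin (d m)) (S n lam nu) *
          e23 (α := Fin a) (R m n mu nu)) (lam : ℂ) (n : ℕ) (hn : n < M + 1) :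
    sndHom a (List.ofFn fun i : Fin n =>
        transfer d ξ R (Fin.castLE hn.le i) (ξ (Fin.castLE hn.le i))).prod *
        monoCyc d ξ a S 0 lam =
      monoCyc d ξ a S ⟨n, hn⟩ lam * sndHom a (List.ofFn fun i : Fin n =>
        transfer d ξ R (Fin.castLE hn.le i) (ξ (Fin.castLE hn.le i))).prod := by
  induction n with
  | zero => simp
  | succ n ih =>
    have hn' : n < M + 1 := (Nat.lt_succ_self n).trans hn
    have hsucc : (⟨n, hn'⟩ : Fin (M + 1)) + 1 = ⟨n + 1, hn⟩ :=
      Fin.ext (Fin.val_add_one_of_lt' hn)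
    have hprod : (List.ofFn fun i : Fin (n + 1) =>
        transfer d ξ R (Fin.castLE hn.le i) (ξ (Fin.castLE hn.le i))).prod =
        (List.ofFn fun i : Fin n =>
          transfer d ξ R (Fin.castLE hn'.le i) (ξ (Fin.castLE hn'.le i))).prod *
        transfer d ξ R ⟨n, hn'⟩ (ξ ⟨n, hn'⟩) := by
      rw [List.ofFn_succ_last, List.prod_append, List.prod_singleton]
      rfl
    have hcomm : Commute (List.ofFn fun i : Fin n =>
          transfer d ξ R (Fin.castLE hn'.le i) (ξ (Fin.castLE hn'.le i))).prod
        (transfer d ξ R ⟨n, hn'⟩ (ξ ⟨n, hn'⟩)) := by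
      refine Commute.list_prod_left _ _ fun y hy => ?_
      obtain ⟨i, rfl⟩ := List.mem_ofFn.mp hy
      exact transfer_commute hP hYB _ _ _
    rw [hprod, hcomm.eq, map_mul, mul_assoc, ih hn', ← mul_assoc,
      transfer_mul_monoCyc _ (hP _) hYB', hsucc, mul_assoc]

end Transfer

end ShiftOperator

/-- the product `T_{1→n} = ∏_{i=1}^{n−1} t⁽ⁱ⁾(ξ_i)` of transfer matrices
intertwines the monodromy matrix (with arbitrary auxiliary space W') with its cyclic
shift from site 1 to site n: `T_{1→n} · T'_{0';1}(λ) = T'_{0';n}(λ) · T_{1→n}`;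
in particular, if each `t⁽ⁱ⁾(ξ_i)` is invertible, then `T_{1→n}` is invertible and
conjugates the monodromy matrix to its cyclic shift. -/
theorem shift_operator_conjugation (d : Fin N → ℕ) (ξ : Fin N → ℂ)
    (R : ∀ m n : Fin N, ℂ → ℂ → Matrix (Fin (d m) × Fin (d n)) (Fin (d m) × Fin (d n)) ℂ)
    (hYB : ∀ (m n p : Fin N) (lam mu nu : ℂ),
      e12 (γ := Fin (d p)) (R m n lam mu) * e13 (β := Fin (d n)) (R m p lam nu) *
          e23 (α := Fin (d m)) (R n p mu nu) =
        e23 (α := Fin (d m)) (R n p mu nu) * e13 (β := Fin (d n)) (R m p lam nu) *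
          e12 (γ := Fin (d p)) (R m n lam mu))
    (hP : ∀ (m n : Fin N) (lam : ℂ), d m = d n →
      ∀ (i k : Fin (d m)) (j l : Fin (d n)),
        R m n lam lam (i, j) (k, l) =
          if (i : ℕ) = (l : ℕ) ∧ (j : ℕ) = (k : ℕ) then 1 else 0)
    (d' : ℕ)
    (R' : ∀ i : Fin N, ℂ → ℂ → Matrix (Fin d' × Fin (d i)) (Fin d' × Fin (d i)) ℂ)
    (hYB' : ∀ (m n : Fin N) (lam mu nu : ℂ),
      e23 (α := Fin d') (R m n mu nu) * e13 (β := Fin (d m)) (R' n lam nu) *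
          e12 (γ := Fin (d n)) (R' m lam mu) =
        e12 (γ := Fin (d n)) (R' m lam mu) * e13 (β := Fin (d m)) (R' n lam nu) *
          e23 (α := Fin d') (R m n mu nu))
    (n : Fin N) (lam : ℂ) :
    idOtimes d' (List.ofFn fun i : Fin n.val =>
          transfer d ξ R (Fin.castLE n.isLt.le i) (ξ (Fin.castLE n.isLt.le i))).prod *
        monoCyc d ξ d' R' ⟨0, n.pos⟩ lam =
      monoCyc d ξ d' R' n lam *
        idOtimes d' (List.ofFn fun i : Fin n.val =>
          transfer d ξ R (Fin.castLE n.isLt.le i) (ξ (Fin.castLE n.isLt.le i))).prod ∧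
      ((∀ i : Fin N, i < n → IsUnit (transfer d ξ R i (ξ i))) →
        IsUnit (List.ofFn fun i : Fin n.val =>
          transfer d ξ R (Fin.castLE n.isLt.le i) (ξ (Fin.castLE n.isLt.le i))).prod ∧
        idOtimes d' (List.ofFn fun i : Fin n.val =>
            transfer d ξ R (Fin.castLE n.isLt.le i) (ξ (Fin.castLE n.isLt.le i))).prod *
          monoCyc d ξ d' R' ⟨0, n.pos⟩ lam *
          (idOtimes d' (List.ofFn fun i : Fin n.val =>
            transfer d ξ R (Fin.castLE n.isLt.le i) (ξ (Fin.castLE n.isLt.le i))).prod)⁻¹ =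
        monoCyc d ξ d' R' n lam) := by
  obtain _ | M := N
  · exact n.elim0
  simp only [← ShiftOperator.sndHom_eq_idOtimes]
  have key := ShiftOperator.prod_transfer_mul_monoCyc (S := R') (R := R) (ξ := ξ)
    (fun k x y z w => by simpa [Fin.ext_iff] using hP k k (ξ k) rfl x z y w)
    hYB hYB' lam n n.isLt
  refine ⟨key, fun hunit => ?_⟩
  have hprod : IsUnit (List.ofFn fun i : Fin n.val =>
      transfer d ξ R (Fin.castLE n.isLt.le i) (ξ (Fin.castLE n.isLt.le i))).prod := by
    refine List.prod_isUnit fun y hy => ?_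
    obtain ⟨i, rfl⟩ := List.mem_ofFn.mp hy
    exact hunit _ i.isLt
  refine ⟨hprod, ?_⟩
  have hdet := (isUnit_iff_isUnit_det _).mp (hprod.map (ShiftOperator.sndHom d'))
  exact (congrArg (· * _) key).trans (mul_nonsing_inv_cancel_right _ _ hdet)
end
end

section
/- For every site index 1 ≤ n ≤ N, the transfer matrix with auxiliary space a copy of W_n, evaluated at the inhomogeneity parameter ξ_n, equals the following product of R-matrices acting on H itself (the auxiliary leg being traded for the n-th tensor factor): t^{(n)}(ξ_n) = R^{n,n−1}_{n,n−1}(ξ_n,ξ_{n−1}) ⋯ R^{n,1}_{n,1}(ξ_n,ξ_1) · R^{n,N}_{n,N}(ξ_n,ξ_N) ⋯ R^{n,n+1}_{n,n+1}(ξ_n,ξ_{n+1}), where R^{n,i}_{n,i}(ξ_n,ξ_i) acts on the n-th and i-th tensor factors of H. This identity requires only the partial-trace cyclicity and the initial condition R^{nn}(ξ_n,ξ_n) = P. -/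
open Matrix

noncomputable section

variable {N : ℕ}

/-- Embedding of a two-site operator on `W_m ⊗ W_i` into H, acting on the `m`-th and
`i`-th tensor factors of H (for `m ≠ i`). -/
def emb2 (d : Fin N → ℕ) (m i : Fin N)
    (M : Matrix (Fin (d m) × Fin (d i)) (Fin (d m) × Fin (d i)) ℂ) :
    Matrix (∀ j, Fin (d j)) (∀ j, Fin (d j)) ℂ :=
  Matrix.of fun x y =>
    M (x m, x i) (y m, y i) *
      ∏ j : Fin N, if j = m ∨ j = i then 1 else (if x j = y j then 1 else 0)

open scoped Kronecker

lemma prod_ite_one_ite {ι : Type*} [Fintype ι] (c e : ι → Prop) [DecidablePred c]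
    [DecidablePred e] :
    (∏ j, if c j then (1 : ℂ) else if e j then 1 else 0) =
      if ∀ j, c j ∨ e j then 1 else 0 := by
  have h : ∀ j, (if c j then (1 : ℂ) else if e j then 1 else 0) =
      if c j ∨ e j then 1 else 0 := fun j => by split_ifs <;> tauto
  simp_rw [h]
  rw [Finset.prod_ite_zero]
  simp

lemma embAux_apply (d : Fin N → ℕ) (n i : Fin N)
    (M : Matrix (Fin (d n) × Fin (d i)) (Fin (d n) × Fin (d i)) ℂ)
    (p q : Fin (d n) × (∀ j, Fin (d j))) :
    embAux d n i M p q = if ∀ j, j = i ∨ p.2 j = q.2 j then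
      M (p.1, p.2 i) (q.1, q.2 i) else 0 := by
  simp [embAux, prod_ite_one_ite]

lemma emb2_apply (d : Fin N → ℕ) (n i : Fin N)
    (M : Matrix (Fin (d n) × Fin (d i)) (Fin (d n) × Fin (d i)) ℂ)
    (x y : ∀ j, Fin (d j)) :
    emb2 d n i M x y = if ∀ j, (j = n ∨ j = i) ∨ x j = y j then
      M (x n, x i) (y n, y i) else 0 := by
  simp [emb2, prod_ite_one_ite]

/-- Exchange of the auxiliary coordinate with the `n`-th site coordinate. -/
def auxSwap (d : Fin N → ℕ) (n : Fin N) :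
    Equiv.Perm (Fin (d n) × (∀ j, Fin (d j))) :=
  Function.Involutive.toPerm (fun p => (p.2 n, Function.update p.2 n p.1))
    (fun p => by simp)

lemma auxSwap_apply (d : Fin N → ℕ) (n : Fin N) (p : Fin (d n) × (∀ j, Fin (d j))) :
    auxSwap d n p = (p.2 n, Function.update p.2 n p.1) := rfl

lemma auxSwap_symm (d : Fin N → ℕ) (n : Fin N) : (auxSwap d n).symm = auxSwap d n := rfl

lemma auxSwap_permMatrix_apply (d : Fin N → ℕ) (n : Fin N)
    (p q : Fin (d n) × (∀ j, Fin (d j))) :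
    (auxSwap d n).permMatrix ℂ p q = if auxSwap d n p = q then 1 else 0 := by
  simp [Equiv.Perm.permMatrix, PEquiv.toMatrix_apply, eq_comm]

lemma auxSwap_permMatrix_mul_self (d : Fin N → ℕ) (n : Fin N) :
    (auxSwap d n).permMatrix ℂ * (auxSwap d n).permMatrix ℂ = 1 := by
  have h : auxSwap d n * auxSwap d n = 1 := by
    ext1 p
    exact (auxSwap d n).symm_apply_apply p
  rw [← Matrix.permMatrix_mul, h, Matrix.permMatrix_one]

lemma embAux_eq_permMatrix (d : Fin N → ℕ) (n : Fin N)
    (M : Matrix (Fin (d n) × Fin (d n)) (Fin (d n) × Fin (d n)) ℂ)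
    (hM : ∀ i k j l, M (i, j) (k, l) = if i = l ∧ j = k then 1 else 0) :
    embAux d n n M = (auxSwap d n).permMatrix ℂ := by
  ext ⟨a, x⟩ ⟨b, y⟩
  rw [embAux_apply, auxSwap_permMatrix_apply, hM, auxSwap_apply, ← ite_and]
  refine if_congr ?_ rfl rfl
  simp only [Prod.mk.injEq, Function.update_eq_iff]
  grind

lemma embAux_mul_permMatrix (d : Fin N → ℕ) {n i : Fin N} (h : i ≠ n)
    (M : Matrix (Fin (d n) × Fin (d i)) (Fin (d n) × Fin (d i)) ℂ) :
    embAux d n i M * (auxSwap d n).permMatrix ℂ =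
      (auxSwap d n).permMatrix ℂ * ((1 : Matrix (Fin (d n)) (Fin (d n)) ℂ) ⊗ₖ emb2 d n i M) := by
  ext ⟨a, x⟩ ⟨b, y⟩
  rw [Equiv.Perm.permMatrix, PEquiv.toMatrix_toPEquiv_mul, PEquiv.mul_toMatrix_toPEquiv,
    auxSwap_symm]
  simp only [Matrix.submatrix_apply, id, auxSwap_apply, Matrix.kronecker_apply, embAux_apply,
    emb2_apply, Matrix.one_apply, Function.update_self, Function.update_of_ne h, ite_mul,
    one_mul, zero_mul, ← ite_and]
  refine if_congr ⟨fun H => ⟨?_, fun j => ?_⟩, fun H j => ?_⟩ rfl rfl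
  · simpa [h.symm] using H n
  · by_cases hj : j = n
    · simp [hj]
    · simpa [hj] using H j
  · by_cases hj : j = n
    · subst hj
      simp [H.1]
    · simpa [hj] using H.2 j

lemma embAux_commute_one_kronecker_emb2 (d : Fin N → ℕ) {n i k : Fin N} (hi : i ≠ n)
    (hik : i ≠ k)
    (A : Matrix (Fin (d n) × Fin (d i)) (Fin (d n) × Fin (d i)) ℂ)
    (B : Matrix (Fin (d n) × Fin (d k)) (Fin (d n) × Fin (d k)) ℂ) :
    Commute (embAux d n i A) ((1 : Matrix (Fin (d n)) (Fin (d n)) ℂ) ⊗ₖ emb2 d n k B) := by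
  ext ⟨a, x⟩ ⟨b, y⟩
  rw [Matrix.mul_apply, Matrix.mul_apply,
    Finset.sum_eq_single (b, Function.update x i (y i)),
    Finset.sum_eq_single (a, Function.update y i (x i))]
  · simp only [Matrix.kronecker_apply, embAux_apply,
      emb2_apply, Matrix.one_apply, Function.update_self, Function.update_of_ne hi.symm,
      Function.update_of_ne hik.symm, if_true, one_mul]
    have h1 : ∀ j, j = i ∨ x j = Function.update x i (y i) j := by grind
    have h2 : ∀ j, j = i ∨ Function.update y i (x i) j = y j := by grind
    have h3 : (∀ j, (j = n ∨ j = k) ∨ Function.update x i (y i) j = y j) ↔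
        ∀ j, (j = n ∨ j = k) ∨ x j = Function.update y i (x i) j :=
      forall_congr' fun j => by grind
    rw [if_pos h1, if_pos h2, mul_comm]
    simp only [h3]
  · rintro ⟨c, z⟩ - hne
    simp only [Matrix.kronecker_apply, embAux_apply, emb2_apply, Matrix.one_apply]
    by_contra H
    refine hne ?_
    have hc : a = c := by grind
    have hx : ∀ j, (j = n ∨ j = k) ∨ x j = z j := by
      by_contra h; exact H (by rw [if_neg h]; simp)
    have hz : ∀ j, j = i ∨ z j = y j := by
      by_contra h; exact H (by rw [if_neg h]; simp)
    rw [hc, Prod.mk.injEq, Function.eq_update_iff]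
    exact ⟨rfl, by grind, by grind⟩
  · simp
  · rintro ⟨c, z⟩ - hne
    simp only [Matrix.kronecker_apply, embAux_apply, emb2_apply, Matrix.one_apply]
    by_contra H
    refine hne ?_
    have hc : c = b := by grind
    have hx : ∀ j, (j = n ∨ j = k) ∨ z j = y j := by
      by_contra h; exact H (by rw [if_neg h]; simp)
    have hz : ∀ j, j = i ∨ x j = z j := by
      by_contra h; exact H (by rw [if_neg h]; simp)
    rw [hc, Prod.mk.injEq, Function.eq_update_iff]
    exact ⟨rfl, by grind, by grind⟩
  · simp

lemma ptr_one_kronecker_mul_mul {α H : Type*} [Fintype α] [DecidableEq α] [Fintype H]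
    (B C : Matrix H H ℂ) (M : Matrix (α × H) (α × H) ℂ) :
    ptr (((1 : Matrix α α ℂ) ⊗ₖ B) * M * ((1 : Matrix α α ℂ) ⊗ₖ C)) = B * ptr M * C := by
  ext x y
  simp only [ptr, Matrix.of_apply, Matrix.mul_apply, Fintype.sum_prod_type,
    Matrix.kronecker_apply, Matrix.one_apply, ite_mul, mul_ite, one_mul, zero_mul, mul_zero,
    Finset.sum_ite_irrel, Finset.sum_const_zero, Finset.sum_ite_eq, Finset.sum_ite_eq',
    Finset.mem_univ, if_true, Finset.mul_sum, Finset.sum_mul]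
  rw [Finset.sum_comm]
  refine Finset.sum_congr rfl fun w _ => ?_
  rw [Finset.sum_comm]

lemma ptr_auxSwap_permMatrix (d : Fin N → ℕ) (n : Fin N) :
    ptr ((auxSwap d n).permMatrix ℂ) = 1 := by
  ext x y
  simp only [ptr, Matrix.of_apply, auxSwap_permMatrix_apply, auxSwap_apply, Matrix.one_apply,
    Prod.mk.injEq, ite_and, Finset.sum_ite_eq, Finset.mem_univ, if_true, Function.update_eq_self]

lemma list_prod_one_kronecker {α H ι : Type*} [Fintype α] [DecidableEq α] [Fintype H]
    [DecidableEq H] (Y : ι → Matrix H H ℂ) (l : List ι) :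
    (l.map fun i => (1 : Matrix α α ℂ) ⊗ₖ Y i).prod = (1 : Matrix α α ℂ) ⊗ₖ (l.map Y).prod := by
  induction l with
  | nil => simp
  | cons i l ih => simp [ih, ← Matrix.mul_kronecker_mul]

lemma list_prod_map_semiconjBy {G ι : Type*} [Monoid G] {P : G} {X Y : ι → G} {l : List ι}
    (h : ∀ i ∈ l, SemiconjBy P (X i) (Y i)) :
    SemiconjBy P (l.map X).prod (l.map Y).prod := by
  induction l with
  | nil => simp
  | cons i l ih =>
    simp only [List.map_cons, List.prod_cons]
    exact (h i (by simp)).mul_right (ih fun j hj => h j (by simp [hj]))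

lemma list_ofFn_add_eq_rotate {α : Type*} (g : Fin N → α) (n : Fin N) :
    (List.ofFn fun j => g (n + j)) = ((List.finRange N).map g).rotate n := by
  refine List.ext_getElem (by simp) fun k h1 h2 => ?_
  simp only [List.getElem_ofFn, List.getElem_rotate, List.getElem_map, List.getElem_finRange,
    List.length_map, List.length_finRange]
  congr 1
  ext
  simp [Fin.val_add, add_comm]

/-- evaluated at `ξ_n`, the transfer matrix with auxiliary space a copy
of `W_n` is the product of R-matrices acting on H itself:
`t⁽ⁿ⁾(ξ_n) = R_{n,n−1}(ξ_n,ξ_{n−1}) ⋯ R_{n,1}(ξ_n,ξ_1) · R_{n,N}(ξ_n,ξ_N) ⋯ R_{n,n+1}(ξ_n,ξ_{n+1})`,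
assuming only the initial condition `R^{nn}(ξ_n,ξ_n) = P`. -/
theorem transfer_eq_Rproduct (d : Fin N → ℕ) (ξ : Fin N → ℂ)
    (R : ∀ m n : Fin N, ℂ → ℂ → Matrix (Fin (d m) × Fin (d n)) (Fin (d m) × Fin (d n)) ℂ)
    (hP : ∀ (m n : Fin N) (lam : ℂ), d m = d n →
      ∀ (i k : Fin (d m)) (j l : Fin (d n)),
        R m n lam lam (i, j) (k, l) =
          if (i : ℕ) = (l : ℕ) ∧ (j : ℕ) = (k : ℕ) then 1 else 0)
    (n : Fin N) :
    transfer d ξ R n (ξ n) =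
      (((List.ofFn fun j : Fin N =>
          emb2 d n (n + j) (R n (n + j) (ξ n) (ξ (n + j)))).tail).reverse).prod := by
  have hsplit : List.finRange N =
      (List.finRange N).take n ++ n :: (List.finRange N).drop (n + 1) := by
    have h := List.drop_eq_getElem_cons (l := List.finRange N) (i := n) (by simp)
    simp only [List.getElem_finRange, Fin.cast_mk, Fin.eta] at h
    exact (List.take_append_drop n _).symm.trans (by rw [h])
  have hlen : ((List.finRange N).take n).length = n := by simp [n.is_lt.le]
  have hnd := List.nodup_finRange N
  generalize (List.finRange N).take n = l₁ at *
  generalize (List.finRange N).drop (n + 1) = l₂ at *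
  rw [hsplit, List.nodup_middle, List.nodup_cons, List.nodup_append] at hnd
  have h₁ : ∀ i ∈ l₁, i ≠ n := by grind
  have h₂ : ∀ i ∈ l₂, i ≠ n := by grind
  have h₁₂ : ∀ i ∈ l₂, ∀ k ∈ l₁, i ≠ k := by grind
  set P := (auxSwap d n).permMatrix ℂ
  set X := fun i => embAux d n i (R n i (ξ n) (ξ i))
  set Y := fun i => emb2 d n i (R n i (ξ n) (ξ i))
  have hXn : X n = P := embAux_eq_permMatrix d n _ fun i k j l => by
    simp [hP n n (ξ n) rfl, Fin.ext_iff]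
  have hPP : P * P = 1 := auxSwap_permMatrix_mul_self d n
  have hXP : ∀ i, i ≠ n → SemiconjBy P ((1 : Matrix (Fin (d n)) (Fin (d n)) ℂ) ⊗ₖ Y i) (X i) :=
    fun i hi => (embAux_mul_permMatrix d hi _).symm
  have hPX : ∀ i, i ≠ n → SemiconjBy P (X i) ((1 : Matrix (Fin (d n)) (Fin (d n)) ℂ) ⊗ₖ Y i) :=
    fun i hi => by
      calc P * X i = P * (X i * P) * P := by simp only [mul_assoc, hPP, mul_one]
        _ = P * P * (1 ⊗ₖ Y i) * P := by rw [← (hXP i hi).eq, mul_assoc P P]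
        _ = (1 ⊗ₖ Y i) * P := by rw [hPP, one_mul]
  have hL := list_prod_map_semiconjBy (P := P) (l := l₂.reverse)
    fun i hi => hXP i (h₂ i (List.mem_reverse.1 hi))
  have hK := list_prod_map_semiconjBy (P := P) (l := l₁.reverse)
    fun i hi => hPX i (h₁ i (List.mem_reverse.1 hi))
  have hcomm : Commute (l₂.reverse.map X).prod
      (l₁.reverse.map fun i => (1 : Matrix (Fin (d n)) (Fin (d n)) ℂ) ⊗ₖ Y i).prod := by
    refine Commute.list_prod_left _ _ fun x hx => Commute.list_prod_right _ _ fun y hy => ?_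
    simp only [List.mem_map, List.mem_reverse] at hx hy
    obtain ⟨i, hi, rfl⟩ := hx
    obtain ⟨k, hk, rfl⟩ := hy
    exact embAux_commute_one_kronecker_emb2 d (h₂ i hi) (h₁₂ i hi k hk) _ _
  have hmono : monodromy d ξ R n (ξ n) =
      (l₂.reverse.map X).prod * (P * (l₁.reverse.map X).prod) := by
    rw [monodromy, List.ofFn_eq_map, hsplit, ← hXn]
    simp [X]
  have hrhs : (List.ofFn fun j => Y (n + j)).tail = l₂.map Y ++ l₁.map Y := by
    have hr := List.rotate_append_length_eq (l₁.map Y) ((n :: l₂).map Y)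
    rw [List.length_map, hlen] at hr
    rw [list_ofFn_add_eq_rotate, hsplit, List.map_append, hr]
    simp
  rw [transfer, hmono, hK.eq, ← mul_assoc, hcomm.eq, mul_assoc, ← hL.eq, ← mul_assoc,
    list_prod_one_kronecker, list_prod_one_kronecker, ptr_one_kronecker_mul_mul,
    ptr_auxSwap_permMatrix, mul_one, hrhs]
  simp
end
end

section
/- Let E be any linear operator on W_1 = ℂ^{d_1}, let E_1 denote the operator on H acting as E on the first tensor factor and as the identity elsewhere, and let E_0 denote E acting on the auxiliary copy of W_1. Then tr_0( E_0 · T^{(1)}_0(ξ_1) ) = E_1 · t^{(1)}(ξ_1), where tr_0 is the partial trace over the auxiliary copy of W_1. -/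
open Matrix

noncomputable section

variable {N : ℕ}

open scoped Kronecker

lemma prod_agree_off (d : Fin N → ℕ) (n : Fin N) (x y : ∀ j, Fin (d j)) :
    (∏ j : Fin N, if j = n then (1 : ℂ) else (if x j = y j then 1 else 0)) =
      if ∀ j, j ≠ n → x j = y j then 1 else 0 := by
  have h : ∀ j : Fin N, (if j = n then (1 : ℂ) else (if x j = y j then 1 else 0)) =
      if j ≠ n → x j = y j then 1 else 0 := by
    intro j
    by_cases hj : j = n <;> simp [hj]
  simp only [h, Finset.prod_ite_zero, Finset.prod_const_one, Finset.mem_univ, true_imp_iff]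

lemma agree_off_iff_eq_update (d : Fin N → ℕ) (n : Fin N) (x y : ∀ j, Fin (d j)) :
    (∀ j, j ≠ n → x j = y j) ↔ y = Function.update x n (y n) := by
  rw [Function.eq_update_iff]
  simp [eq_comm]

lemma sum_agree_off (d : Fin N → ℕ) (n : Fin N) (x : ∀ j, Fin (d j))
    (f : (∀ j, Fin (d j)) → ℂ) :
    (∑ z, if ∀ j, j ≠ n → x j = z j then f z else 0) = ∑ c, f (Function.update x n c) := by
  rw [← Finset.sum_filter]
  symm
  refine Finset.sum_bij (fun c _ => Function.update x n c) ?_ ?_ ?_ ?_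
  · intro c _
    simp +contextual
  · intro a _ b _ h
    exact Function.update_injective x n h
  · intro z hz
    refine ⟨z n, Finset.mem_univ _, ?_⟩
    exact ((agree_off_iff_eq_update d n x z).1 (Finset.mem_filter.1 hz).2).symm
  · intro c _
    rfl

lemma sum_embSite_mul (d : Fin N → ℕ) (n : Fin N) (E : Matrix (Fin (d n)) (Fin (d n)) ℂ)
    (x : ∀ j, Fin (d j)) (f : (∀ j, Fin (d j)) → ℂ) :
    ∑ z, embSite d n E x z * f z = ∑ c, E (x n) c * f (Function.update x n c) := by
  have h := sum_agree_off d n x (fun z => E (x n) (z n) * f z)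
  simp only [Function.update_self] at h
  rw [← h]
  refine Finset.sum_congr rfl fun z _ => ?_
  simp only [embSite, of_apply, prod_agree_off]
  split_ifs <;> simp

lemma sum_mul_embSite (d : Fin N → ℕ) (n : Fin N) (E : Matrix (Fin (d n)) (Fin (d n)) ℂ)
    (y : ∀ j, Fin (d j)) (f : (∀ j, Fin (d j)) → ℂ) :
    ∑ z, f z * embSite d n E z y = ∑ c, f (Function.update y n c) * E c (y n) := by
  have h := sum_agree_off d n y (fun z => f z * E (z n) (y n))
  simp only [Function.update_self] at h
  rw [← h]
  refine Finset.sum_congr rfl fun z _ => ?_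
  simp only [embSite, of_apply, prod_agree_off, eq_comm (a := y _)]
  split_ifs <;> simp

lemma one_kronecker_mul_apply {α H : Type*} [Fintype α] [DecidableEq α] [Fintype H]
    (A : Matrix H H ℂ) (M : Matrix (α × H) (α × H) ℂ) (a : α) (x : H) (q : α × H) :
    (((1 : Matrix α α ℂ) ⊗ₖ A) * M) (a, x) q = ∑ z, A x z * M (a, z) q := by
  simp [mul_apply, Fintype.sum_prod_type, one_apply]

lemma mul_one_kronecker_apply {α H : Type*} [Fintype α] [DecidableEq α] [Fintype H]
    (A : Matrix H H ℂ) (M : Matrix (α × H) (α × H) ℂ) (p : α × H) (a : α) (y : H) :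
    (M * ((1 : Matrix α α ℂ) ⊗ₖ A)) p (a, y) = ∑ z, M p (a, z) * A z y := by
  simp [mul_apply, Fintype.sum_prod_type, one_apply]

lemma ptr_one_kronecker_mul {α H : Type*} [Fintype α] [DecidableEq α] [Fintype H]
    (A : Matrix H H ℂ) (M : Matrix (α × H) (α × H) ℂ) :
    ptr (((1 : Matrix α α ℂ) ⊗ₖ A) * M) = A * ptr M := by
  ext x y
  simp only [ptr, of_apply, one_kronecker_mul_apply]
  rw [Finset.sum_comm]
  simp [mul_apply, Finset.mul_sum]

lemma embFst_mul_apply {α H : Type*} [Fintype α] [Fintype H] [DecidableEq H]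
    (E : Matrix α α ℂ) (M : Matrix (α × H) (α × H) ℂ) (a : α) (x : H) (q : α × H) :
    (embFst E * M : Matrix (α × H) (α × H) ℂ) (a, x) q = ∑ c, E a c * M (c, x) q := by
  simp [mul_apply, Fintype.sum_prod_type, embFst]

lemma mul_embFst_apply {α H : Type*} [Fintype α] [Fintype H] [DecidableEq H]
    (E : Matrix α α ℂ) (M : Matrix (α × H) (α × H) ℂ) (p : α × H) (a : α) (y : H) :
    (M * embFst E : Matrix (α × H) (α × H) ℂ) p (a, y) = ∑ c, M p (c, y) * E c a := by
  simp [mul_apply, Fintype.sum_prod_type, embFst]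

/-- Cyclicity of the partial trace for operators supported on the auxiliary factor. -/
lemma ptr_embFst_mul {α H : Type*} [Fintype α] [Fintype H] [DecidableEq H]
    (E : Matrix α α ℂ) (M : Matrix (α × H) (α × H) ℂ) :
    ptr (embFst E * M) = ptr (M * embFst E) := by
  ext x y
  simp only [ptr, of_apply, embFst_mul_apply, mul_embFst_apply]
  rw [Finset.sum_comm]
  simp only [mul_comm]

/-- Operators acting on the auxiliary factor and site `i` commute with operators on another
site `n`. -/
lemma commute_embAux_embSite (d : Fin N → ℕ) (m n i : Fin N) (hi : i ≠ n)
    (M : Matrix (Fin (d m) × Fin (d i)) (Fin (d m) × Fin (d i)) ℂ)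
    (E : Matrix (Fin (d n)) (Fin (d n)) ℂ) :
    Commute (embAux d m i M) ((1 : Matrix (Fin (d m)) (Fin (d m)) ℂ) ⊗ₖ embSite d n E) := by
  ext ⟨a, x⟩ ⟨b, y⟩
  rw [one_kronecker_mul_apply, mul_one_kronecker_apply, sum_embSite_mul, sum_mul_embSite]
  simp only [embAux, of_apply, prod_agree_off, Function.update_of_ne hi]
  have hl : ∀ c, (∀ j, j ≠ i → x j = Function.update y n c j) ↔
      x n = c ∧ ∀ j, j ≠ i → j ≠ n → x j = y j := by
    intro c
    constructor
    · intro h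
      refine ⟨by simpa using h n hi.symm, fun j hj hn => ?_⟩
      simpa [hn] using h j hj
    · rintro ⟨rfl, h⟩ j hj
      by_cases hn : j = n
      · subst hn; simp
      · simpa [hn] using h j hj hn
  have hr : ∀ c, (∀ j, j ≠ i → Function.update x n c j = y j) ↔
      y n = c ∧ ∀ j, j ≠ i → j ≠ n → x j = y j := by
    intro c
    constructor
    · intro h
      refine ⟨by simpa using (h n hi.symm).symm, fun j hj hn => ?_⟩
      simpa [hn] using h j hj
    · rintro ⟨rfl, h⟩ j hj
      by_cases hn : j = n
      · subst hn; simp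
      · simpa [hn] using h j hj hn
  simp only [hl, hr, ite_and, mul_ite, mul_zero, zero_mul,
    Finset.sum_ite_eq, Finset.mem_univ, if_true, mul_comm]

/-- The permutation operator of the auxiliary factor and site `n` intertwines `E` on these
two factors. -/
lemma embAux_mul_embFst (d : Fin N → ℕ) (n : Fin N)
    (M : Matrix (Fin (d n) × Fin (d n)) (Fin (d n) × Fin (d n)) ℂ)
    (hM : ∀ i k j l, M (i, j) (k, l) = if i = l ∧ j = k then 1 else 0)
    (E : Matrix (Fin (d n)) (Fin (d n)) ℂ) :
    embAux d n n M *
        (embFst E : Matrix (Fin (d n) × (∀ j, Fin (d j))) (Fin (d n) × (∀ j, Fin (d j))) ℂ) =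
      ((1 : Matrix (Fin (d n)) (Fin (d n)) ℂ) ⊗ₖ embSite d n E) * embAux d n n M := by
  ext ⟨a, x⟩ ⟨b, y⟩
  rw [one_kronecker_mul_apply, sum_embSite_mul, mul_embFst_apply]
  have h : ∀ c, (∀ j, j ≠ n → Function.update x n c j = y j) ↔ ∀ j, j ≠ n → x j = y j :=
    fun c => forall₂_congr fun j hj => by simp [hj]
  simp only [embAux, of_apply, prod_agree_off, hM, Function.update_self, h]
  by_cases h1 : a = y n <;> by_cases h2 : ∀ j, j ≠ n → x j = y j <;> simp [h1, h2]

/-- The trace identity at site `0`, for `Fin (N + 1)`-indexed sites. -/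
lemma ptr_embFst_mul_monodromy_zero (d : Fin (N + 1) → ℕ) (ξ : Fin (N + 1) → ℂ)
    (R : ∀ m n : Fin (N + 1),
      ℂ → ℂ → Matrix (Fin (d m) × Fin (d n)) (Fin (d m) × Fin (d n)) ℂ)
    (hP : ∀ i k j l, R 0 0 (ξ 0) (ξ 0) (i, j) (k, l) = if i = l ∧ j = k then 1 else 0)
    (E : Matrix (Fin (d 0)) (Fin (d 0)) ℂ) :
    ptr (embFst E * monodromy d ξ R 0 (ξ 0) :
        Matrix (Fin (d 0) × (∀ j, Fin (d j))) (Fin (d 0) × (∀ j, Fin (d j))) ℂ) =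
      embSite d 0 E * transfer d ξ R 0 (ξ 0) := by
  rw [transfer, ← ptr_one_kronecker_mul, ptr_embFst_mul]
  congr 1
  have hT : monodromy d ξ R 0 (ξ 0) =
      ((List.ofFn fun i : Fin N => embAux d 0 i.succ (R 0 i.succ (ξ 0) (ξ i.succ))).reverse).prod *
        embAux d 0 0 (R 0 0 (ξ 0) (ξ 0)) := by
    rw [monodromy, List.ofFn_succ, List.reverse_cons, List.prod_append, List.prod_singleton]
  have hL : Commute
      ((List.ofFn fun i : Fin N => embAux d 0 i.succ (R 0 i.succ (ξ 0) (ξ i.succ))).reverse).prod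
      ((1 : Matrix (Fin (d 0)) (Fin (d 0)) ℂ) ⊗ₖ embSite d 0 E) := by
    refine Commute.list_prod_left _ _ fun A hA => ?_
    rw [List.mem_reverse, List.mem_ofFn] at hA
    obtain ⟨i, rfl⟩ := hA
    exact commute_embAux_embSite d 0 0 i.succ (Fin.succ_ne_zero i) _ E
  rw [hT, mul_assoc, embAux_mul_embFst d 0 _ hP E, ← mul_assoc, hL.eq, mul_assoc]

/-- if the auxiliary space has the same dimension as the quantum space at
site 1, then for any operator `E` on `W_1`,
`tr₀(E₀ · T⁽¹⁾₀(ξ_1)) = E₁ · t⁽¹⁾(ξ_1)`. -/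
theorem trace_at_first_site (hN : 0 < N) (d : Fin N → ℕ) (ξ : Fin N → ℂ)
    (R : ∀ m n : Fin N, ℂ → ℂ → Matrix (Fin (d m) × Fin (d n)) (Fin (d m) × Fin (d n)) ℂ)
    (hP : ∀ (m n : Fin N) (lam : ℂ), d m = d n →
      ∀ (i k : Fin (d m)) (j l : Fin (d n)),
        R m n lam lam (i, j) (k, l) =
          if (i : ℕ) = (l : ℕ) ∧ (j : ℕ) = (k : ℕ) then 1 else 0)
    (E : Matrix (Fin (d ⟨0, hN⟩)) (Fin (d ⟨0, hN⟩)) ℂ) :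
    ptr (embFst E * monodromy d ξ R ⟨0, hN⟩ (ξ ⟨0, hN⟩)) =
      embSite d ⟨0, hN⟩ E * transfer d ξ R ⟨0, hN⟩ (ξ ⟨0, hN⟩) := by
  cases N with
  | zero => exact absurd hN (lt_irrefl 0)
  | succ N =>
    refine ptr_embFst_mul_monodromy_zero d ξ R (fun i k j l => ?_) E
    simpa only [Fin.ext_iff] using hP 0 0 (ξ 0) rfl i k j l
end
end

section
/- Let λ_1, λ_2, λ_3 ∈ ℂ satisfy λ_1 − λ_2 + η ≠ 0, λ_1 − λ_3 + η ≠ 0 and λ_2 − λ_3 + η ≠ 0. Then the XXX R-matrix satisfies the Yang–Baxter equation R_{12}(λ_1,λ_2) R_{13}(λ_1,λ_3) R_{23}(λ_2,λ_3) = R_{23}(λ_2,λ_3) R_{13}(λ_1,λ_3) R_{12}(λ_1,λ_2) on ℂ² ⊗ ℂ² ⊗ ℂ², where subscripts indicate the pair of tensor factors on which the operator acts. -/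
open Matrix Complex

noncomputable section

/-- The 4×4 R-matrix on ℂ² ⊗ ℂ² with parameters `b`, `c`, in the ordered basis
(e₁⊗e₁, e₁⊗e₂, e₂⊗e₁, e₂⊗e₂) given by [[1,0,0,0],[0,b,c,0],[0,c,b,0],[0,0,0,1]]. -/
def Rmat (b c : ℂ) : Matrix (Fin 2 × Fin 2) (Fin 2 × Fin 2) ℂ :=
  Matrix.of fun p q =>
    if p = q then (if p.1 = p.2 then 1 else b)
    else if p.1 = q.2 ∧ p.2 = q.1 then c else 0

/-- The rational (XXX) R-matrix, with b(λ,μ) = (λ−μ)/(λ−μ+η), c(λ,μ) = η/(λ−μ+η). -/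
def Rxxx (η lam mu : ℂ) : Matrix (Fin 2 × Fin 2) (Fin 2 × Fin 2) ℂ :=
  Rmat ((lam - mu) / (lam - mu + η)) (η / (lam - mu + η))

set_option maxHeartbeats 2000000 in
/-- The Yang–Baxter equation for `Rmat`, under the algebraic relations on the weights
that it requires. -/
theorem Rmat_yang_baxter {b₁ c₁ b₂ c₂ b₃ c₃ : ℂ} (h₁ : b₁ + c₁ = 1) (h₂ : b₂ + c₂ = 1)
    (h₃ : b₃ + c₃ = 1) (h : c₁ * b₂ * c₃ = c₁ * c₂ * b₃ + b₁ * c₂ * c₃) :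
    e12 (γ := Fin 2) (Rmat b₁ c₁) * e13 (β := Fin 2) (Rmat b₂ c₂) *
        e23 (α := Fin 2) (Rmat b₃ c₃) =
      e23 (α := Fin 2) (Rmat b₃ c₃) * e13 (β := Fin 2) (Rmat b₂ c₂) *
        e12 (γ := Fin 2) (Rmat b₁ c₁) := by
  ext ⟨i, j, k⟩ ⟨l, m, n⟩
  fin_cases i <;> fin_cases j <;> fin_cases k <;> fin_cases l <;> fin_cases m <;> fin_cases n <;>
    simp [Matrix.mul_apply, Fintype.sum_prod_type, Fin.sum_univ_two, e12, e13, e23, Rmat] <;>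
    grind

/-- the XXX R-matrix satisfies the Yang–Baxter equation
`R₁₂(λ₁,λ₂) R₁₃(λ₁,λ₃) R₂₃(λ₂,λ₃) = R₂₃(λ₂,λ₃) R₁₃(λ₁,λ₃) R₁₂(λ₁,λ₂)` on ℂ²⊗ℂ²⊗ℂ². -/
theorem xxx_yang_baxter (η : ℂ) (hη : η ≠ 0) (lam₁ lam₂ lam₃ : ℂ)
    (h12 : lam₁ - lam₂ + η ≠ 0) (h13 : lam₁ - lam₃ + η ≠ 0) (h23 : lam₂ - lam₃ + η ≠ 0) :
    e12 (γ := Fin 2) (Rxxx η lam₁ lam₂) * e13 (β := Fin 2) (Rxxx η lam₁ lam₃) *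
        e23 (α := Fin 2) (Rxxx η lam₂ lam₃) =
      e23 (α := Fin 2) (Rxxx η lam₂ lam₃) * e13 (β := Fin 2) (Rxxx η lam₁ lam₃) *
        e12 (γ := Fin 2) (Rxxx η lam₁ lam₂) := by
  unfold Rxxx
  refine Rmat_yang_baxter (by field_simp) (by field_simp) (by field_simp) ?_
  field_simp
  ring
end
end

section
/- Let λ, μ ∈ ℂ be such that sinh(λ − μ + η) ≠ 0, sinh(μ − λ + η) ≠ 0, and sinh(λ − ξ_n + η) ≠ 0, sinh(μ − ξ_n + η) ≠ 0 for every 1 ≤ n ≤ N. Then the XXZ transfer matrices commute: t(λ) t(μ) = t(μ) t(λ) as operators on H. -/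
open Matrix Complex

noncomputable section

/-- The trigonometric (XXZ) R-matrix, with b(λ,μ) = sinh(λ−μ)/sinh(λ−μ+η),
c(λ,μ) = sinh(η)/sinh(λ−μ+η). -/
def Rxxz (η lam mu : ℂ) : Matrix (Fin 2 × Fin 2) (Fin 2 × Fin 2) ℂ :=
  Rmat (Complex.sinh (lam - mu) / Complex.sinh (lam - mu + η))
       (Complex.sinh η / Complex.sinh (lam - mu + η))

variable {N : ℕ}

/-- Embedding of an operator on ℂ²(aux) ⊗ ℂ²(site n) into (aux) ⊗ H, H = ⊗ⁿ ℂ². -/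
def embS (n : Fin N) (M : Matrix (Fin 2 × Fin 2) (Fin 2 × Fin 2) ℂ) :
    Matrix (Fin 2 × (Fin N → Fin 2)) (Fin 2 × (Fin N → Fin 2)) ℂ :=
  Matrix.of fun p q =>
    M (p.1, p.2 n) (q.1, q.2 n) *
      ∏ j : Fin N, if j = n then 1 else (if p.2 j = q.2 j then 1 else 0)

/-- The inhomogeneous XXZ monodromy matrix `T₀(λ) = R₀N(λ,ξ_N) ⋯ R₀1(λ,ξ_1)`. -/
def Tmon (η : ℂ) (ξ : Fin N → ℂ) (lam : ℂ) :
    Matrix (Fin 2 × (Fin N → Fin 2)) (Fin 2 × (Fin N → Fin 2)) ℂ :=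
  ((List.ofFn fun n : Fin N => embS n (Rxxz η lam (ξ n))).reverse).prod

/-- The operator entry `T_{ε,ε'}(λ)` of the monodromy matrix, so that
`T₁₁ = A`, `T₁₂ = B`, `T₂₁ = C`, `T₂₂ = D`. -/
def blkT (η : ℂ) (ξ : Fin N → ℂ) (ε ε' : Fin 2) (lam : ℂ) :
    Matrix (Fin N → Fin 2) (Fin N → Fin 2) ℂ :=
  Matrix.of fun x y => Tmon η ξ lam (ε, x) (ε', y)

/-- The transfer matrix `t(λ) = A(λ) + D(λ)`. -/
def tT (η : ℂ) (ξ : Fin N → ℂ) (lam : ℂ) : Matrix (Fin N → Fin 2) (Fin N → Fin 2) ℂ :=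
  blkT η ξ 0 0 lam + blkT η ξ 1 1 lam

/-- The operator acting as `M` on the `n`-th tensor factor of H and as the identity elsewhere. -/
def embH (n : Fin N) (M : Matrix (Fin 2) (Fin 2) ℂ) :
    Matrix (Fin N → Fin 2) (Fin N → Fin 2) ℂ :=
  Matrix.of fun x y =>
    M (x n) (y n) * ∏ j : Fin N, if j = n then 1 else (if x j = y j then 1 else 0)

/-- The ordered product `∏_{i=1}^{n} (A+D)(ξ_i)` of transfer matrices. -/
def prodT (η : ℂ) (ξ : Fin N → ℂ) (n : ℕ) (h : n ≤ N) :
    Matrix (Fin N → Fin 2) (Fin N → Fin 2) ℂ :=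
  (List.ofFn fun i : Fin n => tT η ξ (ξ (Fin.castLE h i))).prod

/-- `embH` acts as `M` at site `n` and vanishes unless all other sites agree. -/
lemma embH_apply (n : Fin N) (M : Matrix (Fin 2) (Fin 2) ℂ) (x y : Fin N → Fin 2) :
    embH n M x y = if ∀ j, j ≠ n → x j = y j then M (x n) (y n) else 0 := by
  unfold embH
  rw [Matrix.of_apply]
  split_ifs with h
  · rw [Finset.prod_eq_one, mul_one]
    intro j _
    by_cases hj : j = n
    · simp [hj]
    · simp [hj, h j hj]
  · push Not at h
    obtain ⟨j, hj, hxy⟩ := h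
    rw [Finset.prod_eq_zero (Finset.mem_univ j), mul_zero]
    simp [hj, hxy]

lemma embH_mul_apply (n : Fin N) (M : Matrix (Fin 2) (Fin 2) ℂ)
    (F : Matrix (Fin N → Fin 2) (Fin N → Fin 2) ℂ) (x y : Fin N → Fin 2) :
    (embH n M * F) x y = ∑ i, M (x n) i * F (Function.update x n i) y := by
  rw [Matrix.mul_apply]
  symm
  apply Finset.sum_of_injOn (fun i => Function.update x n i)
  · exact (Function.update_injective x n).injOn
  · simp [Set.MapsTo]
  · intro z _ hz
    rw [embH_apply, if_neg, zero_mul]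
    intro h
    refine hz ⟨z n, by simp, ?_⟩
    funext j
    by_cases hj : j = n
    · subst hj; simp
    · simp [hj, h j hj]
  · intro i _
    rw [embH_apply, if_pos]
    · simp
    · intro j hj; simp [hj]

lemma embH_mul (n : Fin N) (M M' : Matrix (Fin 2) (Fin 2) ℂ) :
    embH n (M * M') = embH n M * embH n M' := by
  ext x y
  rw [embH_mul_apply, embH_apply, Matrix.mul_apply]
  have h (i : Fin 2) : (∀ j, j ≠ n → Function.update x n i j = y j) ↔
      ∀ j, j ≠ n → x j = y j :=
    forall₂_congr fun j hj => by rw [Function.update_of_ne hj]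
  simp only [embH_apply, h, Function.update_self]
  split_ifs <;> simp

lemma embH_mul_embH_apply {n m : Fin N} (hnm : n ≠ m) (M M' : Matrix (Fin 2) (Fin 2) ℂ)
    (x y : Fin N → Fin 2) :
    (embH n M * embH m M') x y =
      if ∀ j, j ≠ n → j ≠ m → x j = y j then M (x n) (y n) * M' (x m) (y m) else 0 := by
  rw [embH_mul_apply, Finset.sum_eq_single (y n)]
  · rw [embH_apply, Function.update_of_ne hnm.symm, mul_ite, mul_zero]
    congr 1
    apply propext
    refine forall_congr' fun j => ?_
    by_cases hj : j = n
    · subst hj; simp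
    · simp [hj]
  · intro i _ hi
    rw [embH_apply, if_neg, mul_zero]
    intro h
    exact hi (by simpa using h n hnm)
  · simp

lemma commute_embH {n m : Fin N} (hnm : n ≠ m) (M M' : Matrix (Fin 2) (Fin 2) ℂ) :
    Commute (embH n M) (embH m M') := by
  ext x y
  rw [embH_mul_embH_apply hnm, embH_mul_embH_apply hnm.symm, mul_comm (M _ _)]
  congr 1
  exact propext (forall_congr' fun j => imp.swap)

/-- `embH n` as a homomorphism of `ℂ`-algebras. -/
def embHAlgHom (n : Fin N) :
    Matrix (Fin 2) (Fin 2) ℂ →ₐ[ℂ] Matrix (Fin N → Fin 2) (Fin N → Fin 2) ℂ :=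
  AlgHom.ofLinearMap
    { toFun := embH n
      map_add' := fun M M' => by
        ext x y; simp only [embH, Matrix.of_apply, Matrix.add_apply, add_mul]
      map_smul' := fun r M => by
        ext x y; simp [embH, mul_assoc] }
    (by
      ext x y
      simp only [LinearMap.coe_mk, AddHom.coe_mk, embH_apply, Matrix.one_apply, ← ite_and]
      congr 1
      apply propext
      constructor
      · rintro ⟨h, hn⟩
        funext j
        by_cases hj : j = n
        · exact hj ▸ hn
        · exact h j hj
      · rintro rfl
        simp)
    (embH_mul n)

section RTT

variable {S S' : Type*} [Ring S] [Ring S']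

/-- The product `T₁ T₂` of two operators acting on two distinct auxiliary spaces. -/
def auxMul (T₁ T₂ : Matrix (Fin 2) (Fin 2) S) : Matrix (Fin 2 × Fin 2) (Fin 2 × Fin 2) S :=
  Matrix.of fun p q => T₁ p.1 q.1 * T₂ p.2 q.2

/-- The product `T₂ T₁` of two operators acting on two distinct auxiliary spaces. -/
def auxMulRev (T₁ T₂ : Matrix (Fin 2) (Fin 2) S) : Matrix (Fin 2 × Fin 2) (Fin 2 × Fin 2) S :=
  Matrix.of fun p q => T₂ p.2 q.2 * T₁ p.1 q.1

lemma auxMul_mul {L₁ L₂ T₁ T₂ : Matrix (Fin 2) (Fin 2) S}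
    (h : ∀ a b c d, Commute (L₂ a b) (T₁ c d)) :
    auxMul (L₁ * T₁) (L₂ * T₂) = auxMul L₁ L₂ * auxMul T₁ T₂ := by
  ext p q
  simp only [auxMul, Matrix.of_apply, Matrix.mul_apply, Finset.sum_mul_sum,
    Fintype.sum_prod_type]
  refine Finset.sum_congr rfl fun i _ => Finset.sum_congr rfl fun j _ => ?_
  exact ((h _ _ _ _).symm.mul_mul_mul_comm _ _)

lemma auxMulRev_mul {L₁ L₂ T₁ T₂ : Matrix (Fin 2) (Fin 2) S}
    (h : ∀ a b c d, Commute (L₁ a b) (T₂ c d)) :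
    auxMulRev (L₁ * T₁) (L₂ * T₂) = auxMulRev L₁ L₂ * auxMulRev T₁ T₂ := by
  ext p q
  simp only [auxMulRev, Matrix.of_apply, Matrix.mul_apply, Finset.sum_mul_sum,
    Fintype.sum_prod_type]
  rw [Finset.sum_comm]
  refine Finset.sum_congr rfl fun i _ => Finset.sum_congr rfl fun j _ => ?_
  exact ((h _ _ _ _).symm.mul_mul_mul_comm _ _)

variable [Algebra ℂ S] [Algebra ℂ S']

/-- The relation `R T₁ T₂ = T₂ T₁ R`. -/
def RTT (R : Matrix (Fin 2 × Fin 2) (Fin 2 × Fin 2) ℂ) (T₁ T₂ : Matrix (Fin 2) (Fin 2) S) :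
    Prop :=
  R.map (algebraMap ℂ S) * auxMul T₁ T₂ = auxMulRev T₁ T₂ * R.map (algebraMap ℂ S)

lemma RTT.mul {R : Matrix (Fin 2 × Fin 2) (Fin 2 × Fin 2) ℂ}
    {L₁ L₂ T₁ T₂ : Matrix (Fin 2) (Fin 2) S} (hL : RTT R L₁ L₂) (hT : RTT R T₁ T₂)
    (h₁ : ∀ a b c d, Commute (L₁ a b) (T₂ c d)) (h₂ : ∀ a b c d, Commute (L₂ a b) (T₁ c d)) :
    RTT R (L₁ * T₁) (L₂ * T₂) := by
  unfold RTT at *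
  rw [auxMul_mul h₂, auxMulRev_mul h₁, ← mul_assoc, hL, mul_assoc, hT, mul_assoc]

lemma RTT.one (R : Matrix (Fin 2 × Fin 2) (Fin 2 × Fin 2) ℂ) :
    RTT R (1 : Matrix (Fin 2) (Fin 2) S) 1 := by
  have h₁ : auxMul (1 : Matrix (Fin 2) (Fin 2) S) 1 = 1 := by
    ext ⟨a, b⟩ ⟨c, d⟩
    simp only [auxMul, Matrix.one_apply, Prod.ext_iff, Matrix.of_apply]
    split_ifs <;> simp_all
  have h₂ : auxMulRev (1 : Matrix (Fin 2) (Fin 2) S) 1 = 1 := by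
    ext ⟨a, b⟩ ⟨c, d⟩
    simp only [auxMulRev, Matrix.one_apply, Prod.ext_iff, Matrix.of_apply]
    split_ifs <;> simp_all
  rw [RTT, h₁, h₂, mul_one, one_mul]

lemma RTT.map {R : Matrix (Fin 2 × Fin 2) (Fin 2 × Fin 2) ℂ}
    {T₁ T₂ : Matrix (Fin 2) (Fin 2) S} (h : RTT R T₁ T₂) (f : S →ₐ[ℂ] S') :
    RTT R (T₁.map f) (T₂.map f) := by
  have hR : R.map (algebraMap ℂ S') = (R.map (algebraMap ℂ S)).map f := by
    ext p q; simp
  have h₁ : auxMul (T₁.map f) (T₂.map f) = (auxMul T₁ T₂).map f := by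
    ext p q; simp [auxMul]
  have h₂ : auxMulRev (T₁.map f) (T₂.map f) = (auxMulRev T₁ T₂).map f := by
    ext p q; simp [auxMulRev]
  rw [RTT, hR, h₁, h₂, ← Matrix.map_mul, ← Matrix.map_mul, h]

/-- Commutation of traces over the auxiliary space, for an invertible `R`. -/
lemma RTT.commute_trace {b c : ℂ} (hbc : b ^ 2 - c ^ 2 ≠ 0)
    {T₁ T₂ : Matrix (Fin 2) (Fin 2) S} (h : RTT (Rmat b c) T₁ T₂) :
    Commute (T₁ 0 0 + T₁ 1 1) (T₂ 0 0 + T₂ 1 1) := by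
  have e (p q : Fin 2 × Fin 2) := congrFun (congrFun h p) q
  simp only [Matrix.mul_apply, Fintype.sum_prod_type, Fin.sum_univ_two, auxMul, auxMulRev, Rmat,
    Matrix.of_apply, Matrix.map_apply, ← Algebra.commutes, ← Algebra.smul_def] at e
  have e00 := e (0, 0) (0, 0)
  have e11 := e (1, 1) (1, 1)
  have e1 := e (0, 1) (0, 1)
  have e2 := e (0, 1) (1, 0)
  have e3 := e (1, 0) (0, 1)
  have e4 := e (1, 0) (1, 0)
  simp at e00 e11 e1 e2 e3 e4
  have key : (b ^ 2 - c ^ 2) • (T₁ 0 0 * T₂ 1 1 + T₁ 1 1 * T₂ 0 0) =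
      (b ^ 2 - c ^ 2) • (T₂ 1 1 * T₁ 0 0 + T₂ 0 0 * T₁ 1 1) := by
    linear_combination (norm := module) b • e1 - c • e3 + b • e4 - c • e2
  have key' := smul_right_injective S hbc key
  rw [Commute, SemiconjBy]
  simp only [add_mul, mul_add]
  rw [e00, e11]
  linear_combination (norm := module) key'

end RTT

/-- The blocks of an operator on aux ⊗ `J`, as a `2 × 2` matrix of operators on `J`. -/
abbrev auxBlocks {J : Type*} [Fintype J] [DecidableEq J] :
    Matrix (Fin 2 × J) (Fin 2 × J) ℂ ≃+* Matrix (Fin 2) (Fin 2) (Matrix J J ℂ) :=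
  (Matrix.compRingEquiv (Fin 2) J ℂ).symm

set_option maxHeartbeats 2000000 in
/-- The Yang–Baxter equation for six-vertex weights normalised to `a = 1`. -/
lemma RTT_Rmat {b₁ c₁ b₂ c₂ b₃ c₃ : ℂ} (h₁ : c₂ = b₁ * c₂ * b₃ + c₁ * c₃)
    (h₂ : b₂ * c₃ = b₁ * c₃ + c₁ * c₂ * b₃) (h₃ : c₁ * b₂ = c₁ * b₃ + b₁ * c₂ * c₃) :
    RTT (Rmat b₁ c₁) (auxBlocks (Rmat b₂ c₂)) (auxBlocks (Rmat b₃ c₃)) := by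
  unfold RTT
  ext ⟨a, b⟩ ⟨c, d⟩ i j
  fin_cases a <;> fin_cases b <;> fin_cases c <;> fin_cases d <;> fin_cases i <;> fin_cases j <;>
  simp [Matrix.mul_apply, Matrix.sum_apply, Fintype.sum_prod_type, auxMul, auxMulRev, Rmat,
    Matrix.algebraMap_matrix_apply] <;>
  grind

/-- The Yang–Baxter equation for the trigonometric R-matrix. -/
lemma RTT_Rxxz (η lam mu ξ : ℂ) (h1 : Complex.sinh (lam - mu + η) ≠ 0)
    (hlam : Complex.sinh (lam - ξ + η) ≠ 0) (hmu : Complex.sinh (mu - ξ + η) ≠ 0) :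
    RTT (Rxxz η lam mu) (auxBlocks (Rxxz η lam ξ)) (auxBlocks (Rxxz η mu ξ)) := by
  have hv : lam - ξ = (lam - mu) + (mu - ξ) := by ring
  unfold Rxxz
  rw [hv] at hlam ⊢
  generalize lam - mu = u at *
  generalize mu - ξ = w at *
  have hu := Complex.cosh_sq u
  have hw := Complex.cosh_sq w
  have he := Complex.cosh_sq η
  apply RTT_Rmat <;> field_simp <;> simp only [Complex.sinh_add, Complex.cosh_add] <;> grind

lemma auxBlocks_embS (n : Fin N) (M : Matrix (Fin 2 × Fin 2) (Fin 2 × Fin 2) ℂ) :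
    auxBlocks (embS n M) = (auxBlocks M).map (embHAlgHom n) := rfl

lemma commute_list_prod {S : Type*} [Ring S] (s : S) (l : List (Matrix (Fin 2) (Fin 2) S))
    (h : ∀ L ∈ l, ∀ a b, Commute s (L a b)) (a b : Fin 2) : Commute s (l.prod a b) := by
  induction l generalizing a b with
  | nil =>
    rw [List.prod_nil, Matrix.one_apply]
    split_ifs
    · exact Commute.one_right s
    · exact Commute.zero_right s
  | cons L l ih =>
    rw [List.prod_cons, Matrix.mul_apply]
    exact Commute.sum_right _ _ _ fun i _ =>
      (h L (by simp) a i).mul_right (ih (fun L' hL' => h L' (by simp [hL'])) i b)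

lemma RTT_list_prod (R : Matrix (Fin 2 × Fin 2) (Fin 2 × Fin 2) ℂ)
    (L₁ L₂ : Fin N → Matrix (Fin 2) (Fin 2) (Matrix (Fin 2) (Fin 2) ℂ))
    (h : ∀ n, RTT R (L₁ n) (L₂ n)) (l : List (Fin N)) (hl : l.Nodup) :
    RTT R (l.map fun n => (L₁ n).map (embHAlgHom n)).prod
      (l.map fun n => (L₂ n).map (embHAlgHom n)).prod := by
  induction l with
  | nil => exact RTT.one R
  | cons n l ih =>
    rw [List.nodup_cons] at hl
    have hcomm (L L' : Fin N → Matrix (Fin 2) (Fin 2) (Matrix (Fin 2) (Fin 2) ℂ))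
        (a b c d : Fin 2) : Commute ((L n).map (embHAlgHom n) a b)
          ((l.map fun m => (L' m).map (embHAlgHom m)).prod c d) := by
      apply commute_list_prod
      intro M hM
      obtain ⟨m, hm, rfl⟩ := List.mem_map.1 hM
      have hnm : n ≠ m := fun hnm => hl.1 (hnm ▸ hm)
      exact fun _ _ => commute_embH hnm _ _
    rw [List.map_cons, List.map_cons, List.prod_cons, List.prod_cons]
    exact ((h n).map _).mul (ih hl.2) (hcomm L₁ L₂) (hcomm L₂ L₁)

lemma auxBlocks_Tmon (η : ℂ) (ξ : Fin N → ℂ) (lam : ℂ) :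
    auxBlocks (Tmon η ξ lam) = ((List.finRange N).reverse.map fun n =>
      (auxBlocks (Rxxz η lam (ξ n))).map (embHAlgHom n)).prod := by
  rw [Tmon, map_list_prod, List.ofFn_eq_map, ← List.map_reverse, List.map_map]
  rfl

/-- commutation of the XXZ transfer matrices: `t(λ) t(μ) = t(μ) t(λ)` on H. -/
theorem xxz_transfer_commute (η : ℂ) (hη : Complex.sinh η ≠ 0) {N : ℕ} (ξ : Fin N → ℂ)
    (lam mu : ℂ)
    (h1 : Complex.sinh (lam - mu + η) ≠ 0) (h2 : Complex.sinh (mu - lam + η) ≠ 0)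
    (hlam : ∀ n : Fin N, Complex.sinh (lam - ξ n + η) ≠ 0)
    (hmu : ∀ n : Fin N, Complex.sinh (mu - ξ n + η) ≠ 0) :
    tT η ξ lam * tT η ξ mu = tT η ξ mu * tT η ξ lam := by
  have hRTT : RTT (Rxxz η lam mu) (auxBlocks (Tmon η ξ lam)) (auxBlocks (Tmon η ξ mu)) := by
    rw [auxBlocks_Tmon, auxBlocks_Tmon]
    exact RTT_list_prod _ _ _ (fun n => RTT_Rxxz η lam mu (ξ n) h1 (hlam n) (hmu n)) _
      (List.nodup_reverse.2 (List.nodup_finRange N))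
  refine hRTT.commute_trace ?_
  have hne : Complex.sinh (lam - mu - η) ≠ 0 := by
    rw [← neg_ne_zero, ← Complex.sinh_neg]
    convert h2 using 2
    ring
  have hsq : Complex.sinh (lam - mu) ^ 2 - Complex.sinh η ^ 2 =
      Complex.sinh (lam - mu + η) * Complex.sinh (lam - mu - η) := by
    rw [Complex.sinh_add, Complex.sinh_sub _ η]
    linear_combination Complex.sinh η ^ 2 * Complex.cosh_sq (lam - mu) -
      Complex.sinh (lam - mu) ^ 2 * Complex.cosh_sq η
  rw [div_pow, div_pow, ← sub_div, hsq]
  exact div_ne_zero (mul_ne_zero h1 hne) (pow_ne_zero 2 h1)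
end
end
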